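/- For m ≥ 5, the Vietoris–Rips complex VR(F_1^m ∪ F_3^m, 2) is homotopy equivalent to a wedge sum of (m choose 4) copies of the 3-sphere S³. -/

import Mathlib

open Finset

/-- An abstract simplicial complex on a vertex type `V`: a collection of nonempty
finite subsets of `V` (the faces), closed under taking nonempty subsets. -/
structure AbsSC (V : Type) where
  faces : Set (Finset V)
  not_empty_mem : ∅ ∉ faces
  down_closed : ∀ s ∈ faces, ∀ t : Finset V, t ⊆ s → t ≠ ∅ → t ∈ faces

namespace AbsSC

variable {V W : Type}

/-- The vertex set of a simplicial complex. -/
def vertices (K : AbsSC V) : Set V := {v | ({v} : Finset V) ∈ K.faces}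

/-- The geometric realization of a simplicial complex: the space of convex weightings
supported on a face, topologized as a subspace of `V → ℝ`. -/
def space (K : AbsSC V) : Type :=
  {f : V → ℝ // (∀ v, 0 ≤ f v) ∧ ∃ s ∈ K.faces, (∀ v, f v ≠ 0 → v ∈ s) ∧ ∑ v ∈ s, f v = 1}

instance (K : AbsSC V) : TopologicalSpace K.space := by unfold space; infer_instance

/-- `L` is a subcomplex of `K`. -/
def IsSubcomplex (L K : AbsSC V) : Prop := L.faces ⊆ K.faces

/-- Homotopy equivalence of simplicial complexes (of their geometric realizations). -/
def HEquiv (K : AbsSC V) (L : AbsSC W) : Prop :=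
  Nonempty (ContinuousMap.HomotopyEquiv K.space L.space)

/-- The realization of `K` is homotopy equivalent to the topological space `X`. -/
def HEquivTop (K : AbsSC V) (X : Type) [TopologicalSpace X] : Prop :=
  Nonempty (ContinuousMap.HomotopyEquiv K.space X)

/-- The inclusion of realizations induced by a subcomplex inclusion. -/
def incl {L K : AbsSC V} (h : L.faces ⊆ K.faces) : C(L.space, K.space) where
  toFun f := ⟨f.1, f.2.1, by obtain ⟨s, hs, h1, h2⟩ := f.2.2; exact ⟨s, h hs, h1, h2⟩⟩
  continuous_toFun := Continuous.subtype_mk continuous_subtype_val _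

variable [DecidableEq V]

/-- The link of a vertex. -/
def link (K : AbsSC V) (v : V) : AbsSC V where
  faces := {σ | σ ≠ ∅ ∧ v ∉ σ ∧ σ ∪ {v} ∈ K.faces}
  not_empty_mem h := h.1 rfl
  down_closed := by
    rintro s ⟨hne, hv, hs⟩ t hts htne
    exact ⟨htne, fun hvt => hv (hts hvt),
      K.down_closed _ hs _ (Finset.union_subset_union hts (Finset.Subset.refl _)) (by simp [Finset.union_eq_empty])⟩

lemma link_subset (K : AbsSC V) (v : V) : (K.link v).faces ⊆ K.faces := by
  rintro σ ⟨hne, hv, hσ⟩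
  exact K.down_closed _ hσ _ Finset.subset_union_left hne

/-- The complex induced on the vertices other than `v`. -/
def delete (K : AbsSC V) (v : V) : AbsSC V where
  faces := {σ | σ ∈ K.faces ∧ v ∉ σ}
  not_empty_mem h := K.not_empty_mem h.1
  down_closed := by
    rintro s ⟨hs, hv⟩ t hts htne
    exact ⟨K.down_closed _ hs _ hts htne, fun h => hv (hts h)⟩

/-- The star of a vertex: `st_K(v) = {σ : σ ∪ {v} ∈ K}`. -/
def star (K : AbsSC V) (v : V) : AbsSC V where
  faces := {σ | σ ≠ ∅ ∧ σ ∪ {v} ∈ K.faces}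
  not_empty_mem h := h.1 rfl
  down_closed := by
    rintro s ⟨hne, hs⟩ t hts htne
    exact ⟨htne,
      K.down_closed _ hs _ (Finset.union_subset_union hts (Finset.Subset.refl _)) (by simp [Finset.union_eq_empty])⟩

/-- The star cluster of a subcomplex `L` in `K`: the union of stars of vertices of `L`. -/
def starCluster (K L : AbsSC V) : AbsSC V where
  faces := {σ | σ ≠ ∅ ∧ ∃ v, ({v} : Finset V) ∈ L.faces ∧ σ ∪ {v} ∈ K.faces}
  not_empty_mem h := h.1 rfl
  down_closed := by
    rintro s ⟨hne, v, hvL, hs⟩ t hts htne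
    exact ⟨htne, v, hvL,
      K.down_closed _ hs _ (Finset.union_subset_union hts (Finset.Subset.refl _)) (by simp [Finset.union_eq_empty])⟩

/-- The union of two simplicial complexes. -/
def union (K₁ K₂ : AbsSC V) : AbsSC V where
  faces := K₁.faces ∪ K₂.faces
  not_empty_mem h := by
    rcases h with h | h
    exacts [K₁.not_empty_mem h, K₂.not_empty_mem h]
  down_closed := by
    rintro s (hs | hs) t hts htne
    exacts [Or.inl (K₁.down_closed _ hs _ hts htne), Or.inr (K₂.down_closed _ hs _ hts htne)]

/-- The union of a family of simplicial complexes. -/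
def iUnionC {ι : Type} (F : ι → AbsSC V) : AbsSC V where
  faces := ⋃ i, (F i).faces
  not_empty_mem h := by
    obtain ⟨i, hi⟩ := Set.mem_iUnion.mp h
    exact (F i).not_empty_mem hi
  down_closed := by
    intro s hs t hts htne
    obtain ⟨i, hi⟩ := Set.mem_iUnion.mp hs
    exact Set.mem_iUnion.mpr ⟨i, (F i).down_closed _ hi _ hts htne⟩

/-- The `n`-skeleton of a complex: all faces with at most `n+1` vertices. -/
def skeleton (K : AbsSC V) (n : ℕ) : AbsSC V where
  faces := {σ | σ ∈ K.faces ∧ σ.card ≤ n + 1}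
  not_empty_mem h := K.not_empty_mem h.1
  down_closed := by
    rintro s ⟨hs, hcard⟩ t hts htne
    exact ⟨K.down_closed _ hs _ hts htne, le_trans (Finset.card_le_card hts) hcard⟩

/-- The simplicial complex generated by a single simplex `s` (all its nonempty subsets). -/
def simplexCx (s : Finset V) : AbsSC V where
  faces := {t | t ≠ ∅ ∧ t ⊆ s}
  not_empty_mem h := h.1 rfl
  down_closed := by
    rintro a ⟨hne, has⟩ t hta htne
    exact ⟨htne, hta.trans has⟩

/-- A maximal simplex (facet) of `K`. -/
def IsFacet (K : AbsSC V) (σ : Finset V) : Prop :=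
  σ ∈ K.faces ∧ ∀ τ ∈ K.faces, σ ⊆ τ → τ = σ

/-- `K` is a clique complex: any nonempty set of vertices which pairwise span edges is a face. -/
def IsCliqueCx (K : AbsSC V) : Prop :=
  ∀ σ : Finset V, σ ≠ ∅ → (∀ v ∈ σ, ({v} : Finset V) ∈ K.faces) →
    (∀ v ∈ σ, ∀ w ∈ σ, v ≠ w → ({v, w} : Finset V) ∈ K.faces) → σ ∈ K.faces

/-- `L` is a full subcomplex of `K`. -/
def IsFull (L K : AbsSC V) : Prop :=
  ∀ σ ∈ K.faces, (∀ v ∈ σ, ({v} : Finset V) ∈ L.faces) → σ ∈ L.faces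

end AbsSC

noncomputable section

/-- The `n`-dimensional sphere. -/
abbrev Sph (n : ℕ) : Type := Metric.sphere (0 : EuclideanSpace ℝ (Fin (n + 1))) 1

/-- A base point on the sphere. -/
def sphBase (n : ℕ) : Sph n :=
  ⟨EuclideanSpace.single 0 1, by simp⟩

/-- Relation gluing the base points of `c` copies of a pointed space to an auxiliary point. -/
inductive wedgeRel (c : ℕ) (X : Type) (x₀ : X) : Unit ⊕ Fin c × X → Unit ⊕ Fin c × X → Prop
  | glue (i : Fin c) : wedgeRel c X x₀ (Sum.inl ()) (Sum.inr (i, x₀))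

/-- The wedge sum of `c` copies of the pointed space `(X, x₀)`. -/
def Wedge (c : ℕ) (X : Type) [TopologicalSpace X] (x₀ : X) : Type := Quot (wedgeRel c X x₀)

instance (c : ℕ) (X : Type) [TopologicalSpace X] (x₀ : X) : TopologicalSpace (Wedge c X x₀) := by
  unfold Wedge; infer_instance

/-- The base point of the wedge. -/
def wedgePt (c : ℕ) (X : Type) [TopologicalSpace X] (x₀ : X) : Wedge c X x₀ :=
  Quot.mk _ (Sum.inl ())

/-- The wedge sum of `c` copies of the `n`-sphere. -/
abbrev WedgeSph (n c : ℕ) : Type := Wedge c (Sph n) (sphBase n)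

/-- The base point of a wedge of spheres. -/
def wedgeSphPt (n c : ℕ) : WedgeSph n c := wedgePt c _ _

/-- Relation gluing the two base points in a binary wedge. -/
inductive wedge2Rel (X Y : Type) (x₀ : X) (y₀ : Y) : X ⊕ Y → X ⊕ Y → Prop
  | glue : wedge2Rel X Y x₀ y₀ (Sum.inl x₀) (Sum.inr y₀)

/-- The wedge sum `X ∨ Y` of two pointed spaces. -/
def Wedge2 (X Y : Type) [TopologicalSpace X] [TopologicalSpace Y] (x₀ : X) (y₀ : Y) : Type :=
  Quot (wedge2Rel X Y x₀ y₀)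

instance (X Y : Type) [TopologicalSpace X] [TopologicalSpace Y] (x₀ : X) (y₀ : Y) :
    TopologicalSpace (Wedge2 X Y x₀ y₀) := by unfold Wedge2; infer_instance

/-- Relation collapsing the top and bottom of the cylinder `X × [0,1]` to two cone points. -/
inductive suspRel (X : Type) : X × unitInterval ⊕ Bool → X × unitInterval ⊕ Bool → Prop
  | zero (x : X) : suspRel X (Sum.inl (x, 0)) (Sum.inr false)
  | one (x : X) : suspRel X (Sum.inl (x, 1)) (Sum.inr true)

/-- The (unreduced) suspension `Σ X`. -/
def Susp (X : Type) [TopologicalSpace X] : Type := Quot (suspRel X)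

instance (X : Type) [TopologicalSpace X] : TopologicalSpace (Susp X) := by
  unfold Susp; infer_instance

/-- The north cone point of the suspension. -/
def suspNorth (X : Type) [TopologicalSpace X] : Susp X := Quot.mk _ (Sum.inr true)

end

/-- The Vietoris–Rips complex at scale `r` of a collection `F` of finite subsets of `ℕ`,
with respect to the symmetric difference metric `d(A,B) = |A Δ B|`. -/
def VRc (F : Set (Finset ℕ)) (r : ℕ) : AbsSC (Finset ℕ) where
  faces := {σ | σ.Nonempty ∧ (∀ A ∈ σ, A ∈ F) ∧
    ∀ A ∈ σ, ∀ B ∈ σ, (symmDiff A B).card ≤ r}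
  not_empty_mem h := by simpa using h.1
  down_closed := by
    rintro s ⟨hne, hF, hd⟩ t hts htne
    exact ⟨Finset.nonempty_iff_ne_empty.mpr htne, fun A hA => hF A (hts hA),
      fun A hA B hB => hd A (hts hA) B (hts hB)⟩

/-- `F_n^m`: all `n`-element subsets of `[m] = {1, …, m}`. -/
def Fnm (m n : ℕ) : Set (Finset ℕ) := {A | A ⊆ Finset.Icc 1 m ∧ A.card = n}

/-- `F_{≤ n}^m`: all subsets of `[m]` of cardinality at most `n`. -/
def Fle (m n : ℕ) : Set (Finset ℕ) := {A | A ⊆ Finset.Icc 1 m ∧ A.card ≤ n}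

/-- The simplex `N[C] = {A : C ⊆ A, |A \ C| = 1}` inside `[m]`. -/
def NSimp (m : ℕ) (C : Finset ℕ) : Finset (Finset ℕ) :=
  (Finset.Icc 1 m \ C).image (fun x => insert x C)

/-- The simplex `L[S]`: all subsets of `S` obtained by removing one element. -/
def LSimp (S : Finset ℕ) : Finset (Finset ℕ) := S.image (fun x => S.erase x)

/-- The total order `≺`: first compare cardinalities, then compare the increasing
enumerations lexicographically. -/
def precLT (A B : Finset ℕ) : Prop :=
  A.card < B.card ∨
    (A.card = B.card ∧ List.Lex (· < ·) (A.sort (· ≤ ·)) (B.sort (· ≤ ·)))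

/-- `A ⪯ B`. -/
def precLE (A B : Finset ℕ) : Prop := precLT A B ∨ A = B

/-- `F^m_{≺ A}`: all subsets of `[m]` strictly preceding `A`. -/
def FprecLT (m : ℕ) (A : Finset ℕ) : Set (Finset ℕ) :=
  {B | B ⊆ Finset.Icc 1 m ∧ precLT B A}

/-- `F^m_{⪯ A}`: all subsets of `[m]` preceding (or equal to) `A`. -/
def FprecLE (m : ℕ) (A : Finset ℕ) : Set (Finset ℕ) :=
  {B | B ⊆ Finset.Icc 1 m ∧ precLE B A}

/-- The `j`-th value (0-indexed) of an enumeration `i : Fin n → ℕ`. -/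
def ith {n : ℕ} (i : Fin n → ℕ) (j : ℕ) : ℕ := if h : j < n then i ⟨j, h⟩ else 0

/-- The `ℓ`-th entry (1-indexed) of the enumeration, as an integer, with `i_0 = -1`. -/
def ivZ {n : ℕ} (i : Fin n → ℕ) (ℓ : ℕ) : ℤ := if ℓ = 0 then -1 else (ith i (ℓ - 1) : ℤ)

/-- For `B = i_1 i_2 ⋯ i_n` (increasing), with `d_1 = i_1` and
`d_ℓ = i_ℓ - (i_{ℓ-1} + 1)`, `r_B = Σ_{k=2}^{n-2} C(k,2) + Σ_{ℓ=1}^{n-2} d_ℓ·C(n-ℓ,2)`. -/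
def rA (B : Finset ℕ) : ℕ :=
  (∑ k ∈ Finset.Icc 2 (B.card - 2), Nat.choose k 2) +
    ∑ ℓ ∈ Finset.Icc 1 (B.card - 2),
      ((B.sort (· ≤ ·)).getD (ℓ - 1) 0 -
        (if ℓ = 1 then 0 else (B.sort (· ≤ ·)).getD (ℓ - 2) 0 + 1)) * Nat.choose (B.card - ℓ) 2

/-- For `B = i_1 i_2 ⋯ i_n` (increasing), with `c_1 = i_1 - 1` and
`c_ℓ = i_ℓ - (i_{ℓ-1} + 1)`, `s_B = Σ_{k=2}^{n-2} C(k,2) + Σ_{ℓ=1}^{n-2} c_ℓ·C(n-ℓ,2)`. -/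
def sA (B : Finset ℕ) : ℕ :=
  (∑ k ∈ Finset.Icc 2 (B.card - 2), Nat.choose k 2) +
    ∑ ℓ ∈ Finset.Icc 1 (B.card - 2),
      ((B.sort (· ≤ ·)).getD (ℓ - 1) 0 -
        (if ℓ = 1 then 1 else (B.sort (· ≤ ·)).getD (ℓ - 2) 0 + 1)) * Nat.choose (B.card - ℓ) 2

/-- `t_n = Σ_{A ⊆ [m], |A| = n} r_A`. -/
def tN (m n : ℕ) : ℕ :=
  ∑ A ∈ (Finset.Icc 1 m).powerset.filter (fun A => A.card = n), rA A

/-- `o_{m,n} = Σ { s_A : A ∈ F^m_{n+2}, min A ≥ 2 }`. -/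
def omn (m n : ℕ) : ℕ :=
  ∑ A ∈ (Finset.Icc 1 m).powerset.filter (fun A => A.card = n + 2 ∧ ∀ x ∈ A, 2 ≤ x), sA A

open Topology unitInterval

section QuotientEquiv

/-- A self-homotopy of `X` that is compatible with the fibres of a quotient map `q : X → W` and
ends in a map constant on these fibres makes `q` a homotopy equivalence. -/
theorem nonempty_homotopyEquiv_of_isQuotientMap {X W : Type} [TopologicalSpace X]
    [TopologicalSpace W] (q : C(X, W)) (hq : IsQuotientMap q) (k : C(X, X))
    (hk : (ContinuousMap.id X).HomotopicWith k
      (fun f => ∀ x y, q x = q y → q (f x) = q (f y)))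
    (hconst : ∀ x y, q x = q y → k x = k y) :
    Nonempty (ContinuousMap.HomotopyEquiv X W) := by
  obtain ⟨H⟩ := hk
  let j : C(W, X) := hq.lift k fun x y h => hconst x y h
  have hj : ∀ x, j (q x) = k x := fun x => congrArg (fun f : C(X, X) => f x)
    (hq.lift_comp k fun x y h => hconst x y h)
  let G : C(X, C(I, W)) := ContinuousMap.curry
    (q.comp (H.toHomotopy.toContinuousMap.comp ⟨Prod.swap, continuous_swap⟩))
  have hG : ∀ x t, G x t = q (H (t, x)) := fun _ _ => rfl
  have hfac : Function.FactorsThrough G q := by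
    intro x y h
    ext t
    exact H.prop' t x y h
  let G' : C(W, C(I, W)) := hq.lift G hfac
  have hG' : ∀ x, G' (q x) = G x := fun x => congrArg (fun f : C(X, C(I, W)) => f x)
    (hq.lift_comp G hfac)
  refine ⟨⟨q, j, ?_, ?_⟩⟩
  · have : j.comp q = k := by ext x; exact hj x
    rw [this]
    exact ⟨H.toHomotopy.symm⟩
  · refine ContinuousMap.Homotopic.symm ⟨⟨⟨fun p => G' p.2 p.1, by fun_prop⟩, ?_, ?_⟩⟩
    · intro w
      obtain ⟨x, rfl⟩ := hq.surjective w
      simp only [hG', hG]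
      exact congrArg q (H.apply_zero x)
    · intro w
      obtain ⟨x, rfl⟩ := hq.surjective w
      simp only [hG', hG, ContinuousMap.comp_apply, hj]
      exact congrArg q (H.apply_one x)

end QuotientEquiv

namespace AbsSC

section Realization

variable {V : Type} {K L : AbsSC V} {P : Type} [TopologicalSpace P]

theorem continuous_coord (K : AbsSC V) (v : V) : Continuous fun x : K.space => x.1 v :=
  (continuous_apply v).comp continuous_subtype_val

theorem space_ext {x y : K.space} (h : ∀ v, x.1 v = y.1 v) : x = y := Subtype.ext (funext h)

theorem exists_support (x : K.space) : ∃ s ∈ K.faces, ∀ v, x.1 v ≠ 0 ↔ v ∈ s := by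
  classical
  obtain ⟨s, hs, h1, h2⟩ := x.2.2
  refine ⟨s.filter fun v => x.1 v ≠ 0, K.down_closed s hs _ (filter_subset _ _) ?_, fun v => ?_⟩
  · intro h
    have := Finset.sum_filter_ne_zero s (f := x.1)
    rw [h, h2] at this
    simp at this
  · simpa using h1 v

theorem sum_eq_one (x : K.space) {s : Finset V} (h : ∀ v, x.1 v ≠ 0 → v ∈ s) :
    ∑ v ∈ s, x.1 v = 1 := by
  obtain ⟨t, ht, h1, h2⟩ := x.2.2
  classical
  refine Eq.trans ?_ h2
  rw [← Finset.sum_filter_ne_zero, ← Finset.sum_filter_ne_zero t]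
  congr 1
  ext v
  simp only [mem_filter]
  exact ⟨fun hv => ⟨h1 v hv.2, hv.2⟩, fun hv => ⟨h v hv.2, hv.2⟩⟩

theorem sum_le_one (x : K.space) (s : Finset V) : ∑ v ∈ s, x.1 v ≤ 1 := by
  classical
  obtain ⟨t, ht, h1⟩ := exists_support x
  refine le_of_le_of_eq (Finset.sum_le_sum_of_subset_of_nonneg subset_union_left
    fun v _ _ => x.2.1 v) (sum_eq_one x (s := s ∪ t) fun v hv => mem_union_right _ ((h1 v).1 hv))

/-- Normalizing a continuous family of nonnegative weights supported on faces. -/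
theorem exists_normalize {F : Finset V} (hF : ∀ s ∈ K.faces, s ⊆ F) (g : P → V → ℝ)
    (hg : ∀ v, Continuous fun p => g p v) (h0 : ∀ p v, 0 ≤ g p v)
    (hs : ∀ p, ∃ s ∈ K.faces, ∀ v, g p v ≠ 0 → v ∈ s) (hne : ∀ p, ∃ v, g p v ≠ 0) :
    ∃ f : C(P, K.space), (∀ p v, (f p).1 v = g p v / ∑ w ∈ F, g p w) ∧
      ∀ p v, (f p).1 v ≠ 0 ↔ g p v ≠ 0 := by
  have hpos : ∀ p, 0 < ∑ w ∈ F, g p w := by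
    intro p
    obtain ⟨v, hv⟩ := hne p
    obtain ⟨s, hsK, hs⟩ := hs p
    exact Finset.sum_pos' (fun w _ => h0 p w) ⟨v, hF s hsK (hs v hv), (h0 p v).lt_of_ne' hv⟩
  have hsupp : ∀ p v, g p v / ∑ w ∈ F, g p w ≠ 0 ↔ g p v ≠ 0 := by
    intro p v
    simp [(hpos p).ne']
  refine ⟨⟨fun p => ⟨fun v => g p v / ∑ w ∈ F, g p w,
    fun v => div_nonneg (h0 p v) (hpos p).le, ?_⟩, ?_⟩, fun p v => rfl, hsupp⟩
  · obtain ⟨s, hsK, hs⟩ := hs p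
    refine ⟨s, hsK, fun v hv => hs v ((hsupp p v).1 hv), ?_⟩
    rw [← Finset.sum_div, Finset.sum_subset (hF s hsK) fun v _ hv => ?_, div_self (hpos p).ne']
    by_contra h
    exact hv (hs v h)
  · refine Continuous.subtype_mk (continuous_pi fun v => ?_) _
    exact (hg v).div (continuous_finsetSum _ fun w _ => hg w) fun p => (hpos p).ne'

/-- The straight-line homotopy between maps that pointwise share a face. -/
noncomputable def lineHomotopy (f g : C(P, K.space))
    (h : ∀ p, ∃ s ∈ K.faces, ∀ v, (f p).1 v ≠ 0 ∨ (g p).1 v ≠ 0 → v ∈ s) : f.Homotopy g where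
  toFun tp := ⟨fun v => (1 - (tp.1 : ℝ)) * (f tp.2).1 v + tp.1 * (g tp.2).1 v, fun v =>
      add_nonneg (mul_nonneg (sub_nonneg.2 tp.1.2.2) ((f tp.2).2.1 v))
        (mul_nonneg tp.1.2.1 ((g tp.2).2.1 v)), by
    obtain ⟨s, hs, h⟩ := h tp.2
    refine ⟨s, hs, fun v hv => h v ?_, ?_⟩
    · contrapose! hv
      rw [hv.1, hv.2]
      ring
    · rw [Finset.sum_add_distrib, ← Finset.mul_sum, ← Finset.mul_sum,
        sum_eq_one _ fun v hv => h v (Or.inl hv), sum_eq_one _ fun v hv => h v (Or.inr hv)]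
      ring⟩
  continuous_toFun := by
    refine Continuous.subtype_mk (continuous_pi fun v => ?_) _
    have h1 := (continuous_coord K v).comp (f.continuous.comp (continuous_snd (X := I)))
    have h2 := (continuous_coord K v).comp (g.continuous.comp (continuous_snd (X := I)))
    have h3 : Continuous fun tp : I × P => (tp.1 : ℝ) := by fun_prop
    exact ((continuous_const.sub h3).mul h1).add (h3.mul h2)
  map_zero_left p := space_ext fun v => by simp
  map_one_left p := space_ext fun v => by simp

theorem lineHomotopy_apply (f g : C(P, K.space))
    (h : ∀ p, ∃ s ∈ K.faces, ∀ v, (f p).1 v ≠ 0 ∨ (g p).1 v ≠ 0 → v ∈ s) (t : I) (p : P) (v : V) :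
    (lineHomotopy f g h (t, p)).1 v = (1 - (t : ℝ)) * (f p).1 v + t * (g p).1 v := rfl

end Realization

end AbsSC

section CellMap

/-- The smallest of four numbers. -/
noncomputable def minCoord (y : Fin 4 → ℝ) : ℝ := Finset.univ.inf' univ_nonempty y

theorem minCoord_le (y : Fin 4 → ℝ) (a : Fin 4) : minCoord y ≤ y a :=
  Finset.inf'_le _ (mem_univ a)

theorem exists_minCoord_eq (y : Fin 4 → ℝ) : ∃ a, minCoord y = y a := by
  obtain ⟨a, -, h⟩ := Finset.exists_mem_eq_inf' univ_nonempty y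
  exact ⟨a, h⟩

theorem minCoord_eq {y : Fin 4 → ℝ} {a : Fin 4} (h : ∀ b, y a ≤ y b) : minCoord y = y a := by
  obtain ⟨b, hb⟩ := exists_minCoord_eq y
  exact le_antisymm (minCoord_le y a) (hb ▸ h b)

theorem continuous_minCoord : Continuous minCoord := by
  have := Continuous.finset_inf' (s := (univ : Finset (Fin 4))) (f := fun a (y : Fin 4 → ℝ) => y a)
    univ_nonempty fun a _ => continuous_apply a
  convert this using 1
  ext y
  rw [minCoord, Finset.inf'_apply]

/-- Nonnegative weights of total at most one, which is one if no weight vanishes. -/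
def cellDomain : Set (Fin 4 → ℝ) :=
  {y | (∀ a, 0 ≤ y a) ∧ ∑ a, y a ≤ 1 ∧ (minCoord y = 0 ∨ ∑ a, y a = 1)}

theorem minCoord_nonneg {y : Fin 4 → ℝ} (hy : y ∈ cellDomain) : 0 ≤ minCoord y := by
  obtain ⟨a, ha⟩ := exists_minCoord_eq y
  exact ha ▸ hy.1 a

/-- The denominator of the stereographic formula. -/
noncomputable def cellDenom (y : Fin 4 → ℝ) : ℝ :=
  minCoord y ^ 2 + ∑ a : Fin 3, (y a.succ - y 0) ^ 2 + (1 - ∑ a, y a)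

theorem cellDenom_pos {y : Fin 4 → ℝ} (hy : y ∈ cellDomain) : 0 < cellDenom y := by
  obtain ⟨h0, h1, -⟩ := hy
  have hm := sq_nonneg (minCoord y)
  have hw : 0 ≤ ∑ a : Fin 3, (y a.succ - y 0) ^ 2 := Finset.sum_nonneg fun a _ => sq_nonneg _
  unfold cellDenom
  by_contra! h
  have hw0 : ∑ a : Fin 3, (y a.succ - y 0) ^ 2 = 0 := by linarith
  have hm0 : minCoord y = 0 := pow_eq_zero_iff (two_ne_zero) |>.1 (by linarith)
  rw [Finset.sum_eq_zero_iff_of_nonneg fun a _ => sq_nonneg _] at hw0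
  have hw1 : ∀ b, y b = y 0 := by
    intro b
    refine Fin.cases rfl (fun a => ?_) b
    have := pow_eq_zero_iff (two_ne_zero) |>.1 (hw0 a (mem_univ a))
    linarith
  obtain ⟨a, ha⟩ := exists_minCoord_eq y
  have hy0 : y 0 = 0 := by rw [← hw1 a, ← ha, hm0]
  have hsum : ∑ a, y a = 0 := Finset.sum_eq_zero fun b _ => (hw1 b).trans hy0
  linarith

/-- The coordinates of the stereographic formula. -/
noncomputable def cellVec (y : Fin 4 → ℝ) : Fin 4 → ℝ :=
  Fin.cons (1 - 2 * minCoord y ^ 2 / cellDenom y)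
    fun a => 2 * minCoord y * (y a.succ - y 0) / cellDenom y

theorem cellVec_norm {y : Fin 4 → ℝ} (hy : y ∈ cellDomain) : ∑ a, cellVec y a ^ 2 = 1 := by
  have hD := cellDenom_pos hy
  rw [Fin.sum_univ_succ]
  simp only [cellVec, Fin.cons_zero, Fin.cons_succ, div_pow, ← Finset.sum_div]
  rcases hy.2.2 with h | h
  · simp [h]
  · have hD' : cellDenom y = minCoord y ^ 2 + ∑ a : Fin 3, (y a.succ - y 0) ^ 2 := by
      simp [cellDenom, h]
    have : ∑ a : Fin 3, (2 * minCoord y * (y a.succ - y 0)) ^ 2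
        = 4 * minCoord y ^ 2 * (cellDenom y - minCoord y ^ 2) := by
      rw [hD', add_sub_cancel_left, Finset.mul_sum]
      exact Finset.sum_congr rfl fun a _ => by ring
    rw [this]
    field_simp
    ring

/-- The collapse of the boundary of the tetrahedron, as a map to the three-sphere. -/
noncomputable def cellMap (y : cellDomain) : Sph 3 :=
  ⟨WithLp.toLp 2 (cellVec y.1), by
    rw [mem_sphere_zero_iff_norm, EuclideanSpace.norm_eq]
    simp [cellVec_norm y.2]⟩

theorem cellMap_eq_iff {y : cellDomain} {p : Sph 3} :
    cellMap y = p ↔ ∀ a, cellVec y.1 a = p.1 a := by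
  constructor
  · rintro rfl a
    rfl
  · intro h
    refine Subtype.ext ?_
    ext a
    exact h a

theorem continuous_cellMap : Continuous cellMap := by
  have hm : Continuous fun y : cellDomain => minCoord y.1 :=
    continuous_minCoord.comp continuous_subtype_val
  have hc : ∀ a, Continuous fun y : cellDomain => y.1 a := fun a =>
    (continuous_apply a).comp continuous_subtype_val
  have hD : Continuous fun y : cellDomain => cellDenom y.1 := by
    exact ((hm.pow 2).add (continuous_finsetSum _ fun a _ => ((hc _).sub (hc _)).pow 2)).add
      (continuous_const.sub (continuous_finsetSum _ fun a _ => hc a))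
  refine Continuous.subtype_mk ((PiLp.continuous_toLp 2 _).comp (continuous_pi fun a => ?_)) _
  refine Fin.cases ?_ (fun b => ?_) a
  · simp only [cellVec, Fin.cons_zero]
    exact continuous_const.sub ((continuous_const.mul (hm.pow 2)).div hD
      fun y => (cellDenom_pos y.2).ne')
  · simp only [cellVec, Fin.cons_succ]
    exact ((continuous_const.mul hm).mul ((hc _).sub (hc _))).div hD
      fun y => (cellDenom_pos y.2).ne'

theorem sphBase_apply (n : ℕ) (a : Fin (n + 1)) : (sphBase n).1 a = if a = 0 then 1 else 0 := by
  simp [sphBase]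

theorem cellMap_eq_base_iff {y : cellDomain} : cellMap y = sphBase 3 ↔ minCoord y.1 = 0 := by
  rw [cellMap_eq_iff]
  constructor
  · intro h
    have h0 := h 0
    simpa [cellVec, sphBase_apply, (cellDenom_pos y.2).ne'] using h0
  · intro h a
    refine Fin.cases ?_ (fun b => ?_) a <;> simp [cellVec, sphBase_apply, h]

theorem cellMap_injective {y z : cellDomain} (hy : minCoord y.1 ≠ 0) (h : cellMap y = cellMap z) :
    y.1 = z.1 := by
  have hz : minCoord z.1 ≠ 0 := by
    rwa [Ne, ← cellMap_eq_base_iff, ← h, cellMap_eq_base_iff]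
  have hy1 := (y.2.2.2).resolve_left hy
  have hz1 := (z.2.2.2).resolve_left hz
  have hDy := cellDenom_pos y.2
  have hDz := cellDenom_pos z.2
  have hmy := (minCoord_nonneg y.2).lt_of_ne' hy
  have hmz := (minCoord_nonneg z.2).lt_of_ne' hz
  rw [cellMap_eq_iff] at h
  have h0 : minCoord y.1 ^ 2 * cellDenom z.1 = minCoord z.1 ^ 2 * cellDenom y.1 := by
    have := h 0
    simp only [cellVec, cellMap, Fin.cons_zero] at this
    field_simp at this
    linarith
  have hw : ∀ b, minCoord z.1 * (y.1 b - y.1 0) = minCoord y.1 * (z.1 b - z.1 0) := by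
    intro b
    refine Fin.cases (by simp) (fun a => ?_) b
    have := h a.succ
    simp only [cellVec, cellMap, Fin.cons_succ] at this
    rw [div_eq_div_iff hDy.ne' hDz.ne'] at this
    have hne : minCoord z.1 * cellDenom y.1 ≠ 0 := by positivity
    refine mul_left_cancel₀ hne ?_
    linear_combination minCoord y.1 / 2 * this - (y.1 a.succ - y.1 0) * h0
  obtain ⟨a, ha⟩ := exists_minCoord_eq y.1
  obtain ⟨b, hb⟩ := exists_minCoord_eq z.1
  have hab : y.1 b = y.1 a := by
    have h1 := mul_nonneg hmz.le (sub_nonneg.2 (ha ▸ minCoord_le y.1 b))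
    have h2 := mul_nonneg hmy.le (sub_nonneg.2 (hb ▸ minCoord_le z.1 a))
    have h3 : minCoord z.1 * (y.1 b - y.1 a) = 0 := by linarith [hw a, hw b]
    linarith [(mul_eq_zero.1 h3).resolve_left hz]
  have hc : ∀ c, minCoord z.1 * y.1 c = minCoord y.1 * z.1 c := by
    intro c
    have h1 := hw c
    have h2 := hw b
    rw [hab, ← ha, ← hb] at h2
    linarith
  have hs : minCoord z.1 = minCoord y.1 := by
    have := Finset.sum_congr (rfl : (univ : Finset (Fin 4)) = univ) fun c _ => hc c
    rwa [← Finset.mul_sum, ← Finset.mul_sum, hy1, hz1, mul_one, mul_one] at this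
  funext c
  exact mul_left_cancel₀ hz ((hc c).trans (by rw [hs]))

theorem stdSimplex_subset_cellDomain : stdSimplex ℝ (Fin 4) ⊆ cellDomain :=
  fun _ hy => ⟨hy.1, hy.2.le, Or.inr hy.2⟩

theorem cellMap_surjective (p : Sph 3) :
    ∃ y : stdSimplex ℝ (Fin 4), cellMap ⟨y.1, stdSimplex_subset_cellDomain y.2⟩ = p := by
  have hp : ∑ a, p.1 a ^ 2 = 1 := by
    have := p.2
    rw [mem_sphere_zero_iff_norm, EuclideanSpace.norm_eq, Real.sqrt_eq_one] at this
    simpa using this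
  rw [Fin.sum_univ_succ] at hp
  have hnn : 0 ≤ ∑ a : Fin 3, p.1 a.succ ^ 2 := Finset.sum_nonneg fun a _ => sq_nonneg _
  by_cases h1 : p.1 0 = 1
  · refine ⟨⟨Pi.single 0 1, single_mem_stdSimplex ℝ 0⟩, ?_⟩
    have hbase : p = sphBase 3 := by
      refine Subtype.ext ?_
      ext a
      rw [sphBase_apply]
      refine Fin.cases ?_ (fun b => ?_) a
      · simp [h1]
      · rw [h1] at hp
        have h0 : ∑ a : Fin 3, p.1 a.succ ^ 2 = 0 := by linarith
        rw [Finset.sum_eq_zero_iff_of_nonneg fun a _ => sq_nonneg _] at h0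
        simpa using h0 b (mem_univ b)
    rw [hbase, cellMap_eq_base_iff, minCoord_eq (a := 1)]
    · simp
    · intro b
      by_cases hb : b = 0 <;> simp [hb]
  · have hlt : 0 < 1 - p.1 0 := by
      have : p.1 0 ≤ 1 := by nlinarith
      exact sub_pos.2 (this.lt_of_ne h1)
    let z : Fin 4 → ℝ := Fin.cons 0 fun a => p.1 a.succ / (1 - p.1 0)
    let u : Fin 4 → ℝ := fun a => z a + 1 - minCoord z
    have hu : ∀ a, 1 ≤ u a := fun a => by
      have := minCoord_le z a
      simp only [u]
      linarith
    obtain ⟨a₀, ha₀⟩ := exists_minCoord_eq z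
    have hua₀ : u a₀ = 1 := by simp only [u, ha₀]; ring
    have hS : 0 < ∑ a, u a := Finset.sum_pos (fun a _ => by linarith [hu a]) ⟨0, mem_univ _⟩
    set S := ∑ a, u a with hSdef
    have hy : (fun a => u a / S) ∈ stdSimplex ℝ (Fin 4) :=
      ⟨fun a => div_nonneg (by linarith [hu a]) hS.le, by
        rw [← Finset.sum_div, ← hSdef, div_self hS.ne']⟩
    refine ⟨⟨_, hy⟩, ?_⟩
    have hm : minCoord (fun a => u a / S) = 1 / S := by
      rw [minCoord_eq (a := a₀), hua₀]
      intro b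
      rw [hua₀]
      exact div_le_div_of_nonneg_right (hu b) hS.le
    have hw : ∀ a : Fin 3, u a.succ / S - u 0 / S = p.1 a.succ / (1 - p.1 0) / S := by
      intro a
      simp only [u, z, Fin.cons_zero, Fin.cons_succ]
      ring
    have hD : cellDenom (fun a => u a / S) = 2 / (1 - p.1 0) / S ^ 2 := by
      unfold cellDenom
      rw [hm, hy.2]
      simp only [hw, div_pow, ← Finset.sum_div]
      have : ∑ a : Fin 3, p.1 a.succ ^ 2 = (1 - p.1 0) * (1 + p.1 0) := by linarith
      rw [this]
      field_simp
      ring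
    rw [cellMap_eq_iff]
    intro a
    refine Fin.cases ?_ (fun b => ?_) a
    · simp only [cellVec, Fin.cons_zero, hm, hD]
      field_simp
      ring
    · simp only [cellVec, Fin.cons_succ, hm, hD, hw]
      field_simp

theorem isQuotientMap_cellMap : Topology.IsQuotientMap
    fun y : stdSimplex ℝ (Fin 4) => cellMap ⟨y.1, stdSimplex_subset_cellDomain y.2⟩ :=
  have : CompactSpace (stdSimplex ℝ (Fin 4)) := isCompact_iff_compactSpace.1 (isCompact_stdSimplex ℝ _)
  .of_surjective_continuous cellMap_surjective
    (continuous_cellMap.comp (Continuous.subtype_mk continuous_subtype_val _))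

end CellMap

namespace AbsSC

section CellAttachment

variable {V : Type} {K L : AbsSC V} {c : ℕ} {τ : Fin c → Fin 4 → V}

/-- The barycentric coordinates with respect to the tetrahedron `τ i`. -/
def cellCoord (τ : Fin c → Fin 4 → V) (i : Fin c) (x : K.space) : Fin 4 → ℝ := fun a => x.1 (τ i a)

/-- The depth of a point inside the tetrahedron `τ i`. -/
noncomputable def depth (τ : Fin c → Fin 4 → V) (i : Fin c) (x : K.space) : ℝ :=
  minCoord (cellCoord τ i x)

theorem continuous_cellCoord (i : Fin c) : Continuous (cellCoord (K := K) τ i) :=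
  continuous_pi fun _ => continuous_coord K _

theorem continuous_depth (i : Fin c) : Continuous (depth (K := K) τ i) :=
  continuous_minCoord.comp (continuous_cellCoord i)

theorem depth_nonneg (i : Fin c) (x : K.space) : 0 ≤ depth τ i x := by
  obtain ⟨a, ha⟩ := exists_minCoord_eq (cellCoord τ i x)
  exact (x.2.1 _).trans_eq ha.symm

theorem depth_ne_zero_iff {i : Fin c} {x : K.space} :
    depth τ i x ≠ 0 ↔ ∀ a, x.1 (τ i a) ≠ 0 := by
  obtain ⟨a, ha⟩ := exists_minCoord_eq (cellCoord τ i x)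
  constructor
  · intro h b hb
    exact h (le_antisymm ((minCoord_le (cellCoord τ i x) b).trans_eq hb) (depth_nonneg i x))
  · intro h
    exact fun h0 => h a (ha.symm.trans h0)

variable [DecidableEq V]

/-- `K` consists of the subcomplex `L` and of the tetrahedra with vertices `τ i`. -/
structure IsCellAttachment (K L : AbsSC V) (τ : Fin c → Fin 4 → V) : Prop where
  injective : ∀ i, Function.Injective (τ i)
  mem_iff : ∀ s, s ∈ K.faces ↔ s ∈ L.faces ∨ ∃ i, s = univ.image (τ i)
  notMem : ∀ i, univ.image (τ i) ∉ L.faces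
  image_injective : Function.Injective fun i => univ.image (τ i)

namespace IsCellAttachment

theorem subset (hKL : IsCellAttachment K L τ) : L.faces ⊆ K.faces :=
  fun s hs => (hKL.mem_iff s).2 (Or.inl hs)

theorem card_image (hKL : IsCellAttachment K L τ) (i : Fin c) : (univ.image (τ i)).card = 4 := by
  rw [Finset.card_image_of_injective _ (hKL.injective i)]
  rfl

theorem image_ne_empty (hKL : IsCellAttachment K L τ) (i : Fin c) : univ.image (τ i) ≠ ∅ := by
  rw [← Finset.card_pos.trans nonempty_iff_ne_empty, hKL.card_image]
  norm_num

theorem support_eq (hKL : IsCellAttachment K L τ) {i : Fin c} {x : K.space}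
    (h : depth τ i x ≠ 0) (v : V) : x.1 v ≠ 0 ↔ v ∈ univ.image (τ i) := by
  obtain ⟨s, hs, hsx⟩ := exists_support x
  have hsub : univ.image (τ i) ⊆ s := by
    intro w hw
    obtain ⟨a, -, rfl⟩ := mem_image.1 hw
    exact (hsx _).1 (depth_ne_zero_iff.1 h a)
  rw [hsx v]
  rcases (hKL.mem_iff s).1 hs with hs | ⟨j, rfl⟩
  · exact absurd (L.down_closed s hs _ hsub (hKL.image_ne_empty i)) (hKL.notMem i)
  · rw [Finset.eq_of_subset_of_card_le hsub (by rw [hKL.card_image, hKL.card_image])]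

theorem depth_unique (hKL : IsCellAttachment K L τ) {i j : Fin c} {x : K.space}
    (hi : depth τ i x ≠ 0) (hj : depth τ j x ≠ 0) : i = j := by
  refine hKL.image_injective ?_
  ext v
  rw [← hKL.support_eq hi, ← hKL.support_eq hj]

theorem sum_cellCoord (hKL : IsCellAttachment K L τ) (i : Fin c) (x : K.space) :
    ∑ a, cellCoord τ i x a = ∑ v ∈ univ.image (τ i), x.1 v :=
  (Finset.sum_image (f := x.1) ((hKL.injective i).injOn)).symm

theorem sum_cellCoord_eq_one (hKL : IsCellAttachment K L τ) {i : Fin c} {x : K.space}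
    (h : depth τ i x ≠ 0) : ∑ a, cellCoord τ i x a = 1 :=
  (hKL.sum_cellCoord i x).trans (sum_eq_one x fun v hv => (hKL.support_eq h v).1 hv)

theorem cellCoord_mem (hKL : IsCellAttachment K L τ) (i : Fin c) (x : K.space) :
    cellCoord τ i x ∈ cellDomain :=
  ⟨fun _ => x.2.1 _, (hKL.sum_cellCoord i x).trans_le (sum_le_one x _),
    or_iff_not_imp_left.2 fun h => hKL.sum_cellCoord_eq_one h⟩

theorem depth_eq_zero_iff (hKL : IsCellAttachment K L τ) {x : K.space} :
    (∀ i, depth τ i x = 0) ↔ ∃ s ∈ L.faces, ∀ v, x.1 v ≠ 0 → v ∈ s := by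
  constructor
  · intro h
    obtain ⟨s, hs, hsx⟩ := exists_support x
    rcases (hKL.mem_iff s).1 hs with hs | ⟨j, rfl⟩
    · exact ⟨s, hs, fun v hv => (hsx v).1 hv⟩
    · exact absurd (h j) (depth_ne_zero_iff.2 fun a =>
        (hsx _).2 (mem_image_of_mem _ (mem_univ a)))
  · rintro ⟨s, hs, hsx⟩ i
    by_contra h
    refine hKL.notMem i (L.down_closed s hs _ (fun v hv => hsx v ?_) (hKL.image_ne_empty i))
    exact (hKL.support_eq h v).2 hv

/-- The collapse of the tetrahedron `τ i` modulo its boundary, on all of `K`. -/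
noncomputable def toSphere (hKL : IsCellAttachment K L τ) (i : Fin c) : C(K.space, Sph 3) :=
  ⟨fun x => cellMap ⟨cellCoord τ i x, hKL.cellCoord_mem i x⟩,
    continuous_cellMap.comp (Continuous.subtype_mk (continuous_cellCoord i) _)⟩

theorem toSphere_eq_base_iff (hKL : IsCellAttachment K L τ) {i : Fin c} {x : K.space} :
    hKL.toSphere i x = sphBase 3 ↔ depth τ i x = 0 :=
  cellMap_eq_base_iff

/-- The point `p` of the `i`-th sphere of the wedge. -/
def wedgeMk (i : Fin c) (p : Sph 3) : WedgeSph 3 c := Quot.mk _ (Sum.inr (i, p))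

theorem wedgeMk_base (i : Fin c) : wedgeMk i (sphBase 3) = wedgeSphPt 3 c :=
  (Quot.sound (wedgeRel.glue i)).symm

theorem continuous_wedgeMk (i : Fin c) : Continuous (wedgeMk i) := by
  have h : Continuous fun p : Sph 3 => (Sum.inr (i, p) : Unit ⊕ Fin c × Sph 3) := by fun_prop
  exact continuous_quot_mk.comp h

open Classical in
/-- The underlying function of the collapse of `L` onto the base point of the wedge. -/
noncomputable def toWedgeFun (hKL : IsCellAttachment K L τ) (x : K.space) : WedgeSph 3 c :=
  if h : ∃ i, depth τ i x ≠ 0 then wedgeMk h.choose (hKL.toSphere h.choose x)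
  else wedgeSphPt 3 c

theorem toWedgeFun_eq (hKL : IsCellAttachment K L τ) {i : Fin c} {x : K.space}
    (h : ∀ j, j ≠ i → depth τ j x = 0) :
    hKL.toWedgeFun x = wedgeMk i (hKL.toSphere i x) := by
  by_cases hx : ∃ i, depth τ i x ≠ 0
  · have : hx.choose = i := by
      by_contra hne
      exact hx.choose_spec (h _ hne)
    rw [toWedgeFun, dif_pos hx, this]
  · rw [toWedgeFun, dif_neg hx]
    push Not at hx
    rw [hKL.toSphere_eq_base_iff.2 (hx i), wedgeMk_base]

theorem exists_depth_eq_zero (hKL : IsCellAttachment K L τ) (hc : 0 < c) (x : K.space) :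
    ∃ i, ∀ j, j ≠ i → depth τ j x = 0 := by
  by_cases hx : ∃ i, depth τ i x ≠ 0
  · obtain ⟨i, hi⟩ := hx
    exact ⟨i, fun j hj => by_contra fun h => hj (hKL.depth_unique h hi)⟩
  · push Not at hx
    exact ⟨⟨0, hc⟩, fun j _ => hx j⟩

/-- The collapse of `L` onto the base point of the wedge. -/
noncomputable def toWedge (hKL : IsCellAttachment K L τ) (hc : 0 < c) :
    C(K.space, WedgeSph 3 c) where
  toFun := hKL.toWedgeFun
  continuous_toFun := by
    refine (locallyFinite_of_finite fun i : Fin c =>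
      {x : K.space | ∀ j, j ≠ i → depth τ j x = 0}).continuous ?_ ?_ ?_
    · exact Set.eq_univ_of_forall fun x => Set.mem_iUnion.2 (hKL.exists_depth_eq_zero hc x)
    · intro i
      simp only [Set.ofPred_forall]
      exact isClosed_iInter fun j => isClosed_iInter fun _ =>
        isClosed_eq (continuous_depth j) continuous_const
    · intro i
      refine ContinuousOn.congr (Continuous.continuousOn ?_) fun x hx => hKL.toWedgeFun_eq hx
      exact (continuous_wedgeMk i).comp (hKL.toSphere i).continuous

/-- The retraction of the wedge onto its `i`-th sphere. -/
noncomputable def wedgeRetract (i : Fin c) : WedgeSph 3 c → Sph 3 :=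
  Quot.lift (fun p => p.elim (fun _ => sphBase 3) fun p => if p.1 = i then p.2 else sphBase 3) <| by
    rintro _ _ ⟨j⟩
    simp

theorem wedgeRetract_toWedge (hKL : IsCellAttachment K L τ) (hc : 0 < c) (i : Fin c)
    (x : K.space) : wedgeRetract i (hKL.toWedge hc x) = hKL.toSphere i x := by
  obtain ⟨j, hj⟩ := hKL.exists_depth_eq_zero hc x
  have h : hKL.toWedge hc x = _ := hKL.toWedgeFun_eq hj
  rw [h]
  change (if j = i then hKL.toSphere j x else sphBase 3) = _
  split_ifs with hji
  · rw [hji]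
  · exact (hKL.toSphere_eq_base_iff.2 (hj i fun h => hji h.symm)).symm

theorem toWedge_eq_iff (hKL : IsCellAttachment K L τ) (hc : 0 < c) {x y : K.space} :
    hKL.toWedge hc x = hKL.toWedge hc y ↔
      x = y ∨ (∀ i, depth τ i x = 0) ∧ ∀ i, depth τ i y = 0 := by
  constructor
  · intro h
    have hs : ∀ i, hKL.toSphere i x = hKL.toSphere i y := fun i => by
      rw [← hKL.wedgeRetract_toWedge hc, ← hKL.wedgeRetract_toWedge hc, h]
    have hd : ∀ i, depth τ i x = 0 ↔ depth τ i y = 0 := fun i => by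
      rw [← hKL.toSphere_eq_base_iff, ← hKL.toSphere_eq_base_iff, hs i]
    by_cases hx : ∀ i, depth τ i x = 0
    · exact Or.inr ⟨hx, fun i => (hd i).1 (hx i)⟩
    · push Not at hx
      obtain ⟨i, hi⟩ := hx
      have hi' : depth τ i y ≠ 0 := fun h => hi ((hd i).2 h)
      have hco : cellCoord τ i x = cellCoord τ i y := cellMap_injective (y := ⟨_, hKL.cellCoord_mem i x⟩)
        (z := ⟨_, hKL.cellCoord_mem i y⟩) hi (hs i)
      refine Or.inl (space_ext fun v => ?_)
      by_cases hv : v ∈ univ.image (τ i)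
      · obtain ⟨a, -, rfl⟩ := mem_image.1 hv
        exact congrFun hco a
      · have h1 := (hKL.support_eq hi v).not.2 hv
        have h2 := (hKL.support_eq hi' v).not.2 hv
        push Not at h1 h2
        exact h1.trans h2.symm
  · rintro (rfl | ⟨hx, hy⟩)
    · rfl
    · have h0 : ∀ z : K.space, (∀ i, depth τ i z = 0) → hKL.toWedge hc z = wedgeSphPt 3 c :=
        fun z hz => dif_neg (by push Not; exact hz)
      rw [h0 x hx, h0 y hy]

/-- The inclusion of the tetrahedron `τ i`. -/
noncomputable def cellIncl (hKL : IsCellAttachment K L τ) (i : Fin c) :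
    C(stdSimplex ℝ (Fin 4), K.space) where
  toFun y := ⟨fun v => ∑ a, if τ i a = v then y.1 a else 0,
    fun v => Finset.sum_nonneg fun a _ => by split_ifs <;> [exact y.2.1 a; exact le_rfl],
    univ.image (τ i), (hKL.mem_iff _).2 (Or.inr ⟨i, rfl⟩), by
      constructor
      · intro v hv
        obtain ⟨a, -, ha⟩ := Finset.exists_ne_zero_of_sum_ne_zero hv
        have : τ i a = v := by
          by_contra h
          simp [h] at ha
        exact mem_image.2 ⟨a, mem_univ _, this⟩
      · rw [Finset.sum_comm]
        refine Eq.trans (Finset.sum_congr rfl fun a _ => ?_) y.2.2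
        rw [Finset.sum_ite_eq, if_pos (mem_image_of_mem _ (mem_univ a))]⟩
  continuous_toFun := by
    refine Continuous.subtype_mk (continuous_pi fun v => continuous_finsetSum _ fun a _ => ?_) _
    split_ifs
    · exact (continuous_apply a).comp continuous_subtype_val
    · exact continuous_const

theorem cellCoord_cellIncl (hKL : IsCellAttachment K L τ) (i : Fin c)
    (y : stdSimplex ℝ (Fin 4)) : cellCoord τ i (hKL.cellIncl i y) = y.1 := by
  funext a
  change (∑ b, if τ i b = τ i a then y.1 b else 0) = y.1 a
  simp [(hKL.injective i).eq_iff]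

theorem depth_cellIncl (hKL : IsCellAttachment K L τ) {i j : Fin c} (h : j ≠ i)
    (y : stdSimplex ℝ (Fin 4)) : depth τ j (hKL.cellIncl i y) = 0 := by
  by_contra hj
  refine h (hKL.image_injective (Finset.eq_of_subset_of_card_le ?_
    (by rw [hKL.card_image, hKL.card_image])))
  intro v hv
  have hne : (∑ a, if τ i a = v then y.1 a else 0) ≠ 0 := (hKL.support_eq hj v).2 hv
  obtain ⟨a, -, ha⟩ := Finset.exists_ne_zero_of_sum_ne_zero hne
  refine mem_image.2 ⟨a, mem_univ _, ?_⟩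
  by_contra h
  simp [h] at ha

theorem toSphere_cellIncl (hKL : IsCellAttachment K L τ) (i : Fin c)
    (y : stdSimplex ℝ (Fin 4)) : hKL.toSphere i (hKL.cellIncl i y) =
      cellMap ⟨y.1, stdSimplex_subset_cellDomain y.2⟩ :=
  congrArg cellMap (Subtype.ext (hKL.cellCoord_cellIncl i y))

theorem toWedge_cellIncl (hKL : IsCellAttachment K L τ) (hc : 0 < c) (i : Fin c)
    (y : stdSimplex ℝ (Fin 4)) : hKL.toWedge hc (hKL.cellIncl i y) =
      wedgeMk i (cellMap ⟨y.1, stdSimplex_subset_cellDomain y.2⟩) := by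
  rw [← hKL.toSphere_cellIncl]
  exact hKL.toWedgeFun_eq fun j hj => hKL.depth_cellIncl hj y

theorem isQuotientMap_toWedge (hKL : IsCellAttachment K L τ) (hc : 0 < c) :
    IsQuotientMap (hKL.toWedge hc) := by
  rw [isQuotientMap_iff]
  have hsurj : ∀ (i : Fin c) (p : Sph 3), ∃ x, hKL.toWedge hc x = wedgeMk i p := by
    intro i p
    obtain ⟨y, rfl⟩ := cellMap_surjective p
    exact ⟨_, hKL.toWedge_cellIncl hc i y⟩
  refine ⟨isCoinducing_iff.2 fun U => ⟨fun h => ?_, fun h =>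
    h.preimage (hKL.toWedge hc).continuous⟩, ?_⟩
  · refine (isQuotientMap_quot_mk (r := wedgeRel c (Sph 3) (sphBase 3))).isOpen_preimage.1 ?_
    refine isOpen_sum_iff.2 ⟨isOpen_discrete _, ?_⟩
    refine continuous_Prop.1 (continuous_prod_of_discrete_left.2 fun i => continuous_Prop.2 ?_)
    refine isQuotientMap_cellMap.isOpen_preimage.1 ?_
    convert h.preimage (hKL.cellIncl i).continuous using 1
    ext y
    exact (congrArg (· ∈ U) (hKL.toWedge_cellIncl hc i y)).symm.to_iff
  · rintro ⟨⟨⟩ | ⟨i, p⟩⟩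
    · obtain ⟨x, hx⟩ := hsurj ⟨0, hc⟩ (sphBase 3)
      exact ⟨x, hx.trans (wedgeMk_base _)⟩
    · exact hsurj i p

/-- Pushing a collar of the boundary of each tetrahedron onto the boundary. -/
theorem exists_push (hKL : IsCellAttachment K L τ) {F : Finset V} (hF : ∀ s ∈ K.faces, s ⊆ F) :
    ∃ f : C(K.space, K.space), (∀ x v, (f x).1 v ≠ 0 → x.1 v ≠ 0) ∧
      ∀ x, (∀ i, depth τ i x ≤ 1 / 8) → ∀ i, depth τ i (f x) = 0 := by
  let e : K.space → V → ℝ := fun x v =>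
    ∑ i, if v ∈ univ.image (τ i) then min (depth τ i x) (1 / 8) else 0
  have he0 : ∀ x v, 0 ≤ e x v := fun x v => Finset.sum_nonneg fun i _ => by
    split_ifs
    · exact le_min (depth_nonneg i x) (by norm_num)
    · exact le_rfl
  have hezero : ∀ x, (∀ i, depth τ i x = 0) → ∀ v, e x v = 0 := fun x hx v =>
    Finset.sum_eq_zero fun i _ => by simp [hx i]
  have hesingle : ∀ x i, depth τ i x ≠ 0 → ∀ v,
      e x v = if v ∈ univ.image (τ i) then min (depth τ i x) (1 / 8) else 0 := by
    intro x i hi v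
    refine Finset.sum_eq_single i (fun j _ hj => ?_) (by simp)
    have : depth τ j x = 0 := by_contra fun h => hj (hKL.depth_unique h hi)
    simp [this]
  have hle : ∀ x v, e x v ≤ x.1 v := by
    intro x v
    by_cases hx : ∀ i, depth τ i x = 0
    · exact (hezero x hx v).trans_le (x.2.1 v)
    · push Not at hx
      obtain ⟨i, hi⟩ := hx
      refine (hesingle x i hi v).trans_le ?_
      split_ifs with hv
      · obtain ⟨a, -, rfl⟩ := mem_image.1 hv
        exact (min_le_left _ _).trans (minCoord_le (cellCoord τ i x) a)
      · exact x.2.1 v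
  have hne : ∀ x, ∃ v, x.1 v - e x v ≠ 0 := by
    intro x
    by_cases hx : ∀ i, depth τ i x = 0
    · obtain ⟨s, hs, hsx⟩ := exists_support x
      obtain ⟨v, hv⟩ := nonempty_iff_ne_empty.2 fun h : s = ∅ => K.not_empty_mem (h ▸ hs)
      refine ⟨v, fun h => (hsx v).2 hv ?_⟩
      rwa [hezero x hx v, sub_zero] at h
    · push Not at hx
      obtain ⟨i, hi⟩ := hx
      by_contra! h
      have hlow : ∀ a, cellCoord τ i x a ≤ 1 / 8 := by
        intro a
        have h1 := hesingle x i hi (τ i a)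
        rw [if_pos (mem_image_of_mem _ (mem_univ a))] at h1
        exact (sub_eq_zero.1 (h (τ i a))).trans_le (h1.trans_le (min_le_right _ _))
      have hsum := hKL.sum_cellCoord_eq_one hi
      have := Finset.sum_le_sum fun a (_ : a ∈ univ) => hlow a
      rw [hsum] at this
      norm_num at this
  obtain ⟨f, -, hf⟩ := exists_normalize hF (fun x v => x.1 v - e x v)
    (fun v => (continuous_coord K v).sub (continuous_finsetSum _ fun i _ => by
      split_ifs
      · exact (continuous_depth i).min continuous_const
      · exact continuous_const))
    (fun x v => sub_nonneg.2 (hle x v))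
    (fun x => by
      obtain ⟨s, hs, hsx⟩ := exists_support x
      refine ⟨s, hs, fun v hv => (hsx v).1 fun h0 => hv ?_⟩
      have := hle x v
      rw [h0] at this ⊢
      rw [le_antisymm this (he0 x v), sub_zero])
    hne
  have hsub : ∀ x v, (f x).1 v ≠ 0 → x.1 v ≠ 0 := by
    intro x v hv h0
    refine (hf x v).1 hv ?_
    have := hle x v
    rw [h0] at this ⊢
    rw [le_antisymm this (he0 x v), sub_zero]
  refine ⟨f, hsub, fun x hx i => by_contra fun hi => ?_⟩
  have hix : depth τ i x ≠ 0 := depth_ne_zero_iff.2 fun a => hsub x _ (depth_ne_zero_iff.1 hi a)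
  obtain ⟨a, ha⟩ := exists_minCoord_eq (cellCoord τ i x)
  refine (hf x _).1 (depth_ne_zero_iff.1 hi a) ?_
  rw [hesingle x i hix, if_pos (mem_image_of_mem _ (mem_univ a)), min_eq_left (hx i)]
  exact sub_eq_zero.2 ha.symm

/-- Following a map that sends a collar of `L` into `L` by a contraction of `L`, damped away
from `L`. -/
theorem exists_dampedContraction (hKL : IsCellAttachment K L τ) (f : C(K.space, K.space))
    (hcollar : ∀ x, (∀ i, depth τ i x ≤ 1 / 8) → ∀ i, depth τ i (f x) = 0) {y₀ : L.space}
    (h : (ContinuousMap.id L.space).Homotopy (ContinuousMap.const _ y₀)) :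
    ∃ G : C(I × K.space, K.space), (∀ x, G (0, x) = f x) ∧
      (∀ t x, (∀ i, depth τ i x = 0) → ∀ i, depth τ i (G (t, x)) = 0) ∧
      ∀ x, (∀ i, depth τ i x = 0) → G (1, x) = incl hKL.subset y₀ := by
  let M : K.space → ℝ := fun x => ∑ i, depth τ i x
  have hM : Continuous M := continuous_finsetSum _ fun i _ => continuous_depth i
  have hMle : ∀ x, M x ≤ 1 / 8 → ∀ i, depth τ i x ≤ 1 / 8 := fun x hx i =>
    (Finset.single_le_sum (fun j _ => depth_nonneg j x) (mem_univ i)).trans hx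
  have hM0 : ∀ x, (∀ i, depth τ i x = 0) → M x = 0 := fun x hx =>
    Finset.sum_eq_zero fun i _ => hx i
  have hincl : ∀ (y : L.space) i, depth τ i (incl hKL.subset y) = 0 := by
    intro y
    obtain ⟨s, hs, h1, -⟩ := y.2.2
    exact hKL.depth_eq_zero_iff.2 ⟨s, hs, h1⟩
  let g : {x : K.space // M x ≤ 1 / 8} → L.space := fun x => ⟨(f x.1).1, (f x.1).2.1, by
    obtain ⟨s, hs, h1⟩ := hKL.depth_eq_zero_iff.1 (hcollar x.1 (hMle x.1 x.2))
    exact ⟨s, hs, h1, sum_eq_one (f x.1) h1⟩⟩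
  have hg : Continuous g := Continuous.subtype_mk
    (continuous_subtype_val.comp (f.continuous.comp continuous_subtype_val)) _
  have hgf : ∀ x, incl hKL.subset (g x) = f x.1 := fun x => rfl
  let s : I × K.space → I := fun p => Set.projIcc (0 : ℝ) 1 zero_le_one ((p.1 : ℝ) * (1 - 8 * M p.2))
  have hs : Continuous s := continuous_projIcc.comp (by fun_prop)
  let G : I × K.space → K.space := fun p =>
    if hp : M p.2 ≤ 1 / 8 then incl hKL.subset (h (s p, g ⟨p.2, hp⟩)) else f p.2
  have hGlow : ∀ p (hp : M p.2 ≤ 1 / 8), G p = incl hKL.subset (h (s p, g ⟨p.2, hp⟩)) :=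
    fun p hp => dif_pos hp
  have hGhigh : ∀ p, 1 / 8 ≤ M p.2 → G p = f p.2 := by
    intro p hp
    by_cases hp' : M p.2 ≤ 1 / 8
    · have hs0 : s p = 0 := by
        have : (p.1 : ℝ) * (1 - 8 * M p.2) = 0 := by
          rw [le_antisymm hp' hp]
          norm_num
        simp only [s, this]
        exact Set.projIcc_left zero_le_one
      rw [hGlow p hp', hs0, h.apply_zero]
      exact hgf _
    · exact dif_neg hp'
  have hGcont : Continuous G := by
    have h2 : Continuous fun p : I × K.space => M p.2 := hM.comp continuous_snd
    have hlow : ContinuousOn G {p | M p.2 ≤ 1 / 8} := by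
      rw [continuousOn_iff_continuous_domRestrict]
      have : Continuous fun p : {p : I × K.space | M p.2 ≤ 1 / 8} =>
          incl hKL.subset (h (s p.1, g ⟨p.1.2, p.2⟩)) :=
        (incl hKL.subset).continuous.comp (h.continuous.comp
          ((hs.comp continuous_subtype_val).prodMk (hg.comp
            (Continuous.subtype_mk (continuous_snd.comp continuous_subtype_val) _))))
      convert this using 1
      funext p
      exact hGlow p.1 p.2
    have hhigh : ContinuousOn G {p | 1 / 8 ≤ M p.2} :=
      (f.continuous.comp continuous_snd).continuousOn.congr fun p hp => hGhigh p hp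
    have := hlow.union_of_isClosed hhigh (isClosed_le h2 continuous_const)
      (isClosed_le continuous_const h2)
    rw [← continuousOn_univ]
    convert this using 1
    ext p
    simp [le_total]
  have hGbase : ∀ t x, (∀ i, depth τ i x = 0) → ∀ i, depth τ i (G (t, x)) = 0 := by
    intro t x hx
    have hx' : M x ≤ 1 / 8 := by rw [hM0 x hx]; norm_num
    rw [hGlow (t, x) hx']
    exact hincl _
  have hG0 : ∀ x, G (0, x) = f x := by
    intro x
    by_cases hx : M x ≤ 1 / 8
    · have hs0 : s (0, x) = 0 := by
        simp only [s, Set.Icc.coe_zero, zero_mul]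
        exact Set.projIcc_left zero_le_one
      refine (hGlow (0, x) hx).trans ?_
      rw [hs0, h.apply_zero]
      exact hgf _
    · exact dif_neg hx
  refine ⟨⟨G, hGcont⟩, hG0, hGbase, fun x hx => ?_⟩
  have hx' : M x ≤ 1 / 8 := by rw [hM0 x hx]; norm_num
  have hs1 : s (1, x) = 1 := by
    simp only [s, hM0 x hx, Set.Icc.coe_one, mul_zero, sub_zero, mul_one]
    exact Set.projIcc_right zero_le_one
  refine (hGlow (1, x) hx').trans ?_
  rw [hs1, h.apply_one]
  rfl

/-- The homotopy contracting `L` extends over `K`. -/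
theorem exists_homotopicWith (hKL : IsCellAttachment K L τ) {F : Finset V}
    (hF : ∀ s ∈ K.faces, s ⊆ F) (hL : ContractibleSpace L.space) :
    ∃ k : C(K.space, K.space),
      (ContinuousMap.id K.space).HomotopicWith k
        (fun f => ∀ x, (∀ i, depth τ i x = 0) → ∀ i, depth τ i (f x) = 0) ∧
      ∃ z, ∀ x, (∀ i, depth τ i x = 0) → k x = z := by
  obtain ⟨f, hsub, hcollar⟩ := hKL.exists_push hF
  obtain ⟨y₀, ⟨h⟩⟩ := id_nullhomotopic L.space
  obtain ⟨G, hG0, hGbase, hG1⟩ := hKL.exists_dampedContraction f hcollar h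
  have hface : ∀ x : K.space, ∃ s ∈ K.faces,
      ∀ v, (ContinuousMap.id K.space x).1 v ≠ 0 ∨ (f x).1 v ≠ 0 → v ∈ s := by
    intro x
    obtain ⟨s, hs, hsx⟩ := exists_support x
    exact ⟨s, hs, fun v hv => (hsx v).1 (hv.elim id (hsub x v))⟩
  refine ⟨G.comp ⟨fun x => (1, x), by fun_prop⟩, ?_, incl hKL.subset y₀, hG1⟩
  refine ContinuousMap.HomotopicWith.trans (g := f)
    ⟨⟨lineHomotopy (ContinuousMap.id K.space) f hface, fun t x hx i => ?_⟩⟩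
    ⟨⟨⟨G, hG0, fun x => rfl⟩, fun t x hx => hGbase t x hx⟩⟩
  by_contra hi
  refine depth_ne_zero_iff.2 (fun a h0 => depth_ne_zero_iff.1 hi a ?_) (hx i)
  refine (lineHomotopy_apply _ _ hface t x _).trans ?_
  have hf0 : (f x).1 (τ i a) = 0 := by_contra fun h => hsub x _ h h0
  have hx0 : (ContinuousMap.id K.space x).1 (τ i a) = 0 := h0
  rw [hf0, hx0]
  ring

/-- Attaching `c` tetrahedra to a contractible complex gives a wedge of `c` three-spheres. -/
theorem hEquivTop_wedgeSph (hKL : IsCellAttachment K L τ) (hc : 0 < c) {F : Finset V}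
    (hF : ∀ s ∈ K.faces, s ⊆ F) (hL : ContractibleSpace L.space) :
    K.HEquivTop (WedgeSph 3 c) := by
  obtain ⟨k, ⟨H⟩, z, hz⟩ := hKL.exists_homotopicWith hF hL
  refine nonempty_homotopyEquiv_of_isQuotientMap (hKL.toWedge hc) (hKL.isQuotientMap_toWedge hc) k
    ⟨⟨H.toHomotopy, fun t x y hxy => ?_⟩⟩ fun x y hxy => ?_
  · rcases (hKL.toWedge_eq_iff hc).1 hxy with rfl | ⟨hx, hy⟩
    · rfl
    · exact (hKL.toWedge_eq_iff hc).2 (Or.inr ⟨H.prop' t x hx, H.prop' t y hy⟩)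
  · rcases (hKL.toWedge_eq_iff hc).1 hxy with rfl | ⟨hx, hy⟩
    · rfl
    · rw [hz x hx, hz y hy]

end IsCellAttachment

end CellAttachment

end AbsSC

section Rips

theorem card_symmDiff_add_two_mul_card_inter (A B : Finset ℕ) :
    (symmDiff A B).card + 2 * (A ∩ B).card = A.card + B.card := by
  have h1 := Finset.card_sdiff_add_card_inter A B
  have h2 := Finset.card_sdiff_add_card_inter B A
  have h3 : (symmDiff A B).card = (A \ B).card + (B \ A).card :=
    Finset.card_union_of_disjoint disjoint_sdiff_sdiff
  rw [inter_comm B A] at h2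
  omega

/-- Two triples at distance at most two have at most one element outside each other. -/
theorem eq_of_notMem_of_card_symmDiff_le {A B : Finset ℕ} (hA : A.card = 3) (hB : B.card = 3)
    (h : (symmDiff A B).card ≤ 2) {p q : ℕ} (hp : p ∈ A) (hq : q ∈ A) (hpB : p ∉ B)
    (hqB : q ∉ B) : p = q := by
  have h1 := card_symmDiff_add_two_mul_card_inter A B
  have h2 := Finset.card_sdiff_add_card_inter A B
  have h3 : (A \ B).card ≤ 1 := by omega
  exact Finset.card_le_one.1 h3 _ (mem_sdiff.2 ⟨hp, hpB⟩) _ (mem_sdiff.2 ⟨hq, hqB⟩)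

theorem card_symmDiff_singleton_le_iff {i : ℕ} {A : Finset ℕ} (hA : A.card = 3) :
    (symmDiff {i} A).card ≤ 2 ↔ i ∈ A := by
  have h1 := card_symmDiff_add_two_mul_card_inter {i} A
  rw [card_singleton, hA] at h1
  by_cases hi : i ∈ A
  · rw [singleton_inter_of_mem hi, card_singleton] at h1
    simp only [hi, iff_true]
    omega
  · rw [singleton_inter_of_notMem hi, card_empty] at h1
    simp only [hi, iff_false]
    omega

theorem card_symmDiff_singleton_singleton_le (i j : ℕ) :
    (symmDiff ({i} : Finset ℕ) {j}).card ≤ 2 := by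
  have h1 := card_symmDiff_add_two_mul_card_inter {i} {j}
  simp only [card_singleton] at h1
  omega

theorem mem_LSimp {S A : Finset ℕ} : A ∈ LSimp S ↔ ∃ p ∈ S, S.erase p = A := mem_image

/-- A tetrahedron `LSimp S` is a face. -/
theorem LSimp_mem_faces {m : ℕ} {S : Finset ℕ} (hS : S ∈ powersetCard 4 (Icc 1 m)) :
    LSimp S ∈ (VRc (Fnm m 1 ∪ Fnm m 3) 2).faces := by
  obtain ⟨hSm, hS4⟩ := mem_powersetCard.1 hS
  have hne : S.Nonempty := card_pos.1 (by omega)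
  refine ⟨hne.image _, fun A hA => ?_, fun A hA B hB => ?_⟩
  · obtain ⟨p, hp, rfl⟩ := mem_LSimp.1 hA
    exact Or.inr ⟨(erase_subset _ _).trans hSm, by rw [card_erase_of_mem hp, hS4]⟩
  · obtain ⟨p, hp, rfl⟩ := mem_LSimp.1 hA
    obtain ⟨q, hq, rfl⟩ := mem_LSimp.1 hB
    refine (Finset.card_le_card (t := {p, q}) fun z => ?_).trans card_le_two
    simp only [mem_symmDiff, mem_erase, mem_insert, mem_singleton]
    tauto

/-- A face whose triples have no common element is a tetrahedron. -/
theorem exists_eq_LSimp {m : ℕ} (hm : 1 ≤ m) {s : Finset (Finset ℕ)}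
    (hs : s ∈ (VRc (Fnm m 1 ∪ Fnm m 3) 2).faces)
    (h : ∀ i ∈ Icc 1 m, ∃ A ∈ s, A.card = 3 ∧ i ∉ A) :
    ∃ S ∈ powersetCard 4 (Icc 1 m), s = LSimp S := by
  obtain ⟨-, hF, hd⟩ := hs
  have hsub : ∀ A ∈ s, A ⊆ Icc 1 m := fun A hA => (hF A hA).elim (·.1) (·.1)
  have hfar : ∀ A ∈ s, ∀ B ∈ s, A.card = 3 → B.card = 3 → ∀ p ∈ A, ∀ q ∈ A, p ∉ B → q ∉ B →
      p = q := fun A hA B hB hA3 hB3 p hp q hq =>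
    eq_of_notMem_of_card_symmDiff_le hA3 hB3 (hd A hA B hB) hp hq
  obtain ⟨A, hA, hA3, -⟩ := h 1 (mem_Icc.2 ⟨le_rfl, hm⟩)
  have hopp : ∀ p q r, p ≠ q → p ≠ r → q ≠ r → A = {p, q, r} →
      ∃ x, x ∉ A ∧ ({x, q, r} : Finset ℕ) ∈ s ∧ ({x, q, r} : Finset ℕ).card = 3 := by
    intro p q r hpq hpr hqr hApqr
    have hp : p ∈ A := by simp [hApqr]
    have hq : q ∈ A := by simp [hApqr]
    have hr : r ∈ A := by simp [hApqr]
    obtain ⟨B, hB, hB3, hpB⟩ := h p (hsub A hA hp)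
    have hqB : q ∈ B := by_contra fun hqB => hpq (hfar A hA B hB hA3 hB3 p hp q hq hpB hqB)
    have hrB : r ∈ B := by_contra fun hrB => hpr (hfar A hA B hB hA3 hB3 p hp r hr hpB hrB)
    have hcard : (B \ {q, r}).card = 1 := by
      rw [card_sdiff_of_subset (by simp [insert_subset_iff, hqB, hrB]), hB3, card_pair hqr]
    obtain ⟨x, hx⟩ := card_eq_one.1 hcard
    have hxB : x ∈ B \ {q, r} := by simp [hx]
    have hBx : B = {x, q, r} := by
      rw [insert_eq, ← hx, sdiff_union_of_subset (by simp [insert_subset_iff, hqB, hrB])]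
    simp only [mem_sdiff, mem_insert, mem_singleton, not_or] at hxB
    refine ⟨x, fun hxA => ?_, hBx ▸ hB, hBx ▸ hB3⟩
    simp only [hApqr, mem_insert, mem_singleton] at hxA
    rcases hxA with rfl | hxA
    · exact hpB hxB.1
    · exact hxA.elim hxB.2.1 hxB.2.2
  obtain ⟨a, b, c, hab, hac, hbc, rfl⟩ := card_eq_three.1 hA3
  obtain ⟨x, hx, hxs, hx3⟩ := hopp a b c hab hac hbc rfl
  obtain ⟨y, hy, hys, hy3⟩ := hopp b a c hab.symm hbc hac (insert_comm a b {c})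
  obtain ⟨z, hz, hzs, hz3⟩ := hopp c a b hac.symm hbc.symm hab (by
    rw [insert_comm c a, pair_comm c b])
  have hS4 : ({x, a, b, c} : Finset ℕ).card = 4 := by
    rw [card_insert_of_notMem hx, hA3]
  have hxA := erase_insert hx
  simp only [mem_insert, mem_singleton, not_or] at hx hy hz
  have hxy : x = y := by
    by_contra hxy
    exact hx.2.1 (hfar _ hxs _ hys hx3 hy3 x (by simp) b (by simp) (by simp [hxy, hx])
      (by simp [Ne.symm hy.2.1, hab.symm, hbc]))
  have hxz : x = z := by
    by_contra hxz
    exact hx.2.2 (hfar _ hxs _ hzs hx3 hz3 x (by simp) c (by simp) (by simp [hxz, hx])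
      (by simp [Ne.symm hz.2.2, hac.symm, hbc.symm]))
  subst hxy hxz
  have herase : ∀ p q r : ℕ, x ≠ p → p ≠ q → p ≠ r →
      ({x, p, q, r} : Finset ℕ).erase p = {x, q, r} := fun p q r hxp hpq hpr => by
    rw [erase_insert_of_ne hxp, erase_insert (by simp [hpq, hpr])]
  have hle : LSimp {x, a, b, c} ⊆ s := by
    intro T hT
    obtain ⟨p, hp, rfl⟩ := mem_LSimp.1 hT
    simp only [mem_insert, mem_singleton] at hp
    rcases hp with rfl | rfl | rfl | rfl
    · rwa [hxA]
    · rwa [herase _ _ _ hx.1 hab hac]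
    · rwa [insert_comm a, herase _ _ _ hx.2.1 hab.symm hbc]
    · rwa [pair_comm b, insert_comm a, herase _ _ _ hx.2.2 hac.symm hbc.symm]
  refine ⟨{x, a, b, c}, mem_powersetCard.2 ⟨?_, hS4⟩, Finset.Subset.antisymm (fun T hT => ?_) hle⟩
  · exact insert_subset_iff.2 ⟨hsub _ hxs (mem_insert_self _ _), hsub _ hA⟩
  · generalize ({x, a, b, c} : Finset ℕ) = S at *
    have hmem : ∀ p ∈ S, S.erase p ∈ s := fun p hp => hle (mem_LSimp.2 ⟨p, hp, rfl⟩)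
    have hcard : ∀ p ∈ S, (S.erase p).card = 3 := fun p hp => by
      rw [card_erase_of_mem hp, hS4]
    obtain ⟨p₀, hp₀⟩ : S.Nonempty := card_pos.1 (by omega)
    rcases hF T hT with ⟨-, hT1⟩ | ⟨-, hT3⟩
    · obtain ⟨i, rfl⟩ := card_eq_one.1 hT1
      have hi : ∀ p ∈ S, i ∈ S.erase p := fun p hp =>
        (card_symmDiff_singleton_le_iff (hcard p hp)).1 (hd _ hT _ (hmem p hp))
      exact absurd (hi i (mem_of_mem_erase (hi p₀ hp₀))) (notMem_erase i S)
    · have hTS : T ⊆ S := by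
        intro y hyT
        by_contra hyS
        obtain ⟨q, hqT, hqy⟩ := Finset.exists_mem_ne (by omega : 1 < T.card) y
        have hq : ∀ p ∈ S, q ∈ S.erase p := fun p hp => by_contra fun hqp =>
          hqy (hfar T hT _ (hmem p hp) hT3 (hcard p hp) q hqT y hyT hqp
            fun hyp => hyS (mem_of_mem_erase hyp))
        exact notMem_erase q S (hq q (mem_of_mem_erase (hq p₀ hp₀)))
      obtain ⟨p, hp, hpT⟩ := Finset.exists_mem_notMem_of_card_lt_card (by omega : T.card < S.card)
      exact mem_LSimp.2 ⟨p, hp, (Finset.eq_of_subset_of_card_le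
        (fun z hz => mem_erase.2 ⟨by rintro rfl; exact hpT hz, hTS hz⟩)
        (by rw [hcard p hp, hT3])).symm⟩

/-- The faces of the Vietoris–Rips complex of the singletons and triples of `[m]` whose triples
have a common element. -/
def concurrentComplex (m : ℕ) : AbsSC (Finset ℕ) where
  faces := {s | s ∈ (VRc (Fnm m 1 ∪ Fnm m 3) 2).faces ∧
    ∃ i ∈ Icc 1 m, ∀ A ∈ s, A.card = 3 → i ∈ A}
  not_empty_mem h := AbsSC.not_empty_mem _ h.1
  down_closed := by
    rintro s ⟨hs, i, hi, h⟩ t hts htne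
    exact ⟨AbsSC.down_closed _ s hs t hts htne, i, hi, fun A hA => h A (hts hA)⟩

theorem LSimp_notMem_concurrentComplex {m : ℕ} {S : Finset ℕ}
    (hS : S ∈ powersetCard 4 (Icc 1 m)) : LSimp S ∉ (concurrentComplex m).faces := by
  rintro ⟨-, i, -, h⟩
  have hS4 := (mem_powersetCard.1 hS).2
  have hi : ∀ p ∈ S, i ∈ S.erase p := fun p hp =>
    h _ (mem_LSimp.2 ⟨p, hp, rfl⟩) (by rw [card_erase_of_mem hp, hS4])
  obtain ⟨p₀, hp₀⟩ : S.Nonempty := card_pos.1 (by omega)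
  exact notMem_erase i S (hi i (mem_of_mem_erase (hi p₀ hp₀)))

theorem LSimp_injOn : Set.InjOn LSimp {S | S.card = 4} := by
  have hsup : ∀ S : Finset ℕ, S.card = 4 → (LSimp S).biUnion id = S := by
    intro S hS
    ext z
    simp only [mem_biUnion, mem_LSimp, id]
    constructor
    · rintro ⟨_, ⟨p, -, rfl⟩, hz⟩
      exact mem_of_mem_erase hz
    · intro hz
      obtain ⟨q, hq, hqz⟩ := Finset.exists_mem_ne (by omega : 1 < S.card) z
      exact ⟨_, ⟨q, hq, rfl⟩, mem_erase.2 ⟨hqz.symm, hz⟩⟩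
  intro S hS T hT h
  rw [← hsup S hS, h, hsup T hT]

/-- The Vietoris–Rips complex arises from `concurrentComplex m` by attaching the tetrahedra
`LSimp S`. -/
theorem exists_isCellAttachment {m : ℕ} (hm : 1 ≤ m) :
    ∃ τ : Fin (m.choose 4) → Fin 4 → Finset ℕ,
      AbsSC.IsCellAttachment (VRc (Fnm m 1 ∪ Fnm m 3) 2) (concurrentComplex m) τ := by
  let e : powersetCard 4 (Icc 1 m) ≃ Fin (m.choose 4) :=
    Finset.equivFinOfCardEq (by rw [card_powersetCard, Nat.card_Icc, Nat.add_sub_cancel])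
  let S : Fin (m.choose 4) → Finset ℕ := fun i => (e.symm i).1
  have hS : ∀ i, S i ∈ powersetCard 4 (Icc 1 m) := fun i => (e.symm i).2
  have hS4 : ∀ i, (S i).card = 4 := fun i => (mem_powersetCard.1 (hS i)).2
  have hSinj : Function.Injective S := Subtype.val_injective.comp e.symm.injective
  let τ : Fin (m.choose 4) → Fin 4 → Finset ℕ := fun i a =>
    (S i).erase ((S i).orderEmbOfFin (hS4 i) a)
  have hτ : ∀ i, univ.image (τ i) = LSimp (S i) := fun i => by
    rw [LSimp, ← Finset.image_orderEmbOfFin_univ (S i) (hS4 i), image_image]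
    simp [τ, Function.comp_def]
  refine ⟨τ, fun i a b hab => ?_, fun s => ⟨fun hs => ?_, ?_⟩, fun i => ?_, fun i j hij => ?_⟩
  · exact ((S i).orderEmbOfFin (hS4 i)).injective
      (Finset.erase_injOn (S i) (Finset.orderEmbOfFin_mem _ _ a) (Finset.orderEmbOfFin_mem _ _ b)
        hab)
  · by_cases h : ∃ i ∈ Icc 1 m, ∀ A ∈ s, A.card = 3 → i ∈ A
    · exact Or.inl ⟨hs, h⟩
    · push Not at h
      obtain ⟨T, hT, rfl⟩ := exists_eq_LSimp hm hs h
      refine Or.inr ⟨e ⟨T, hT⟩, ?_⟩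
      rw [hτ]
      simp [S]
  · rintro (hs | ⟨i, rfl⟩)
    · exact hs.1
    · rw [hτ]
      exact LSimp_mem_faces (hS i)
  · rw [hτ]
    exact LSimp_notMem_concurrentComplex (hS i)
  · simp only [hτ] at hij
    exact hSinj (LSimp_injOn (hS4 i) (hS4 j) hij)

theorem subset_of_mem_faces {m : ℕ} {s : Finset (Finset ℕ)}
    (hs : s ∈ (VRc (Fnm m 1 ∪ Fnm m 3) 2).faces) :
    s ⊆ powersetCard 1 (Icc 1 m) ∪ powersetCard 3 (Icc 1 m) := fun A hA => by
  rw [mem_union, mem_powersetCard, mem_powersetCard]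
  exact hs.2.1 A hA

theorem powersetCard_one_mem_faces {m : ℕ} (hm : 1 ≤ m) :
    powersetCard 1 (Icc 1 m) ∈ (concurrentComplex m).faces := by
  have h1 : 1 ∈ Icc 1 m := mem_Icc.2 ⟨le_rfl, hm⟩
  refine ⟨⟨⟨{1}, mem_powersetCard.2 ⟨singleton_subset_iff.2 h1, card_singleton 1⟩⟩,
    fun A hA => Or.inl (mem_powersetCard.1 hA), fun A hA B hB => ?_⟩, 1, h1, fun A hA hA3 => ?_⟩
  · obtain ⟨i, rfl⟩ := card_eq_one.1 (mem_powersetCard.1 hA).2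
    obtain ⟨j, rfl⟩ := card_eq_one.1 (mem_powersetCard.1 hB).2
    exact card_symmDiff_singleton_singleton_le i j
  · have := (mem_powersetCard.1 hA).2
    omega

section Contraction

variable {m : ℕ}

/-- The average weight of the triples, slightly lowered. -/
noncomputable def threshold (x : (concurrentComplex m).space) : ℝ :=
  (∑ T ∈ powersetCard 3 (Icc 1 m), x.1 T) / ((powersetCard 3 (Icc 1 m)).card + 1)

/-- The total weight of the triples not containing a given set. -/
noncomputable def missingWeight (x : (concurrentComplex m).space) (A : Finset ℕ) : ℝ :=
  ∑ T ∈ powersetCard 3 (Icc 1 m) with ¬A ⊆ T, x.1 T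

theorem continuous_threshold : Continuous (threshold (m := m)) :=
  (continuous_finsetSum _ fun T _ => AbsSC.continuous_coord _ T).div_const _

theorem continuous_missingWeight (A : Finset ℕ) :
    Continuous fun x : (concurrentComplex m).space => missingWeight x A :=
  continuous_finsetSum _ fun T _ => AbsSC.continuous_coord _ T

theorem threshold_nonneg (x : (concurrentComplex m).space) : 0 ≤ threshold x :=
  div_nonneg (Finset.sum_nonneg fun T _ => x.2.1 T) (by positivity)

/-- If some triple has positive weight, some triple lies above the threshold. -/
theorem exists_threshold_lt {x : (concurrentComplex m).space} (h : 0 < threshold x) :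
    ∃ T ∈ powersetCard 3 (Icc 1 m), threshold x < x.1 T := by
  by_contra! hle
  have h1 := Finset.sum_le_card_nsmul _ _ _ hle
  have h2 : ∑ T ∈ powersetCard 3 (Icc 1 m), x.1 T =
      threshold x * ((powersetCard 3 (Icc 1 m)).card + 1) :=
    (div_mul_cancel₀ _ (by positivity)).symm
  rw [h2, nsmul_eq_mul] at h1
  linarith

theorem threshold_pos {x : (concurrentComplex m).space} {T : Finset ℕ}
    (hT : T ∈ powersetCard 3 (Icc 1 m)) (hx : x.1 T ≠ 0) : 0 < threshold x :=
  div_pos (Finset.sum_pos' (fun T _ => x.2.1 T) ⟨T, hT, (x.2.1 T).lt_of_ne' hx⟩) (by positivity)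

/-- The weights with those of the triples lowered by the threshold. -/
noncomputable def loweredWeight (x : (concurrentComplex m).space) (A : Finset ℕ) : ℝ :=
  if A.card = 3 then max 0 (x.1 A - threshold x) else x.1 A

/-- Weights on the singletons, positive at the singletons contained in all triples. -/
noncomputable def singletonWeight (x : (concurrentComplex m).space) (A : Finset ℕ) : ℝ :=
  if A ∈ powersetCard 1 (Icc 1 m) then x.1 A + max 0 (threshold x - missingWeight x A) else 0

theorem loweredWeight_nonneg (x : (concurrentComplex m).space) (A : Finset ℕ) :
    0 ≤ loweredWeight x A := by
  unfold loweredWeight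
  split_ifs
  exacts [le_max_left _ _, x.2.1 A]

theorem singletonWeight_nonneg (x : (concurrentComplex m).space) (A : Finset ℕ) :
    0 ≤ singletonWeight x A := by
  unfold singletonWeight
  split_ifs
  exacts [add_nonneg (x.2.1 A) (le_max_left _ _), le_rfl]

theorem continuous_loweredWeight (A : Finset ℕ) :
    Continuous fun x : (concurrentComplex m).space => loweredWeight x A := by
  unfold loweredWeight
  split_ifs
  exacts [continuous_const.max ((AbsSC.continuous_coord _ A).sub continuous_threshold),
    AbsSC.continuous_coord _ A]

theorem continuous_singletonWeight (A : Finset ℕ) :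
    Continuous fun x : (concurrentComplex m).space => singletonWeight x A := by
  unfold singletonWeight
  split_ifs
  exacts [(AbsSC.continuous_coord _ A).add
    (continuous_const.max (continuous_threshold.sub (continuous_missingWeight A))),
    continuous_const]

theorem threshold_lt_of_loweredWeight_ne_zero {x : (concurrentComplex m).space} {A : Finset ℕ}
    (hA : A.card = 3) (h : loweredWeight x A ≠ 0) : threshold x < x.1 A := by
  by_contra! hle
  exact h ((if_pos hA).trans (max_eq_left (sub_nonpos.2 hle)))

theorem ne_zero_of_loweredWeight_ne_zero {x : (concurrentComplex m).space} {A : Finset ℕ}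
    (h : loweredWeight x A ≠ 0) : x.1 A ≠ 0 := by
  by_cases hA : A.card = 3
  · exact ((threshold_nonneg x).trans_lt (threshold_lt_of_loweredWeight_ne_zero hA h)).ne'
  · rwa [loweredWeight, if_neg hA] at h

theorem exists_loweredWeight_ne_zero (x : (concurrentComplex m).space) :
    ∃ A, loweredWeight x A ≠ 0 := by
  rcases (threshold_nonneg x).eq_or_lt with h | h
  · obtain ⟨s, hs, hsx⟩ := AbsSC.exists_support x
    obtain ⟨A, hA⟩ := hs.1.1
    have hxA := (hsx A).2 hA
    refine ⟨A, fun h0 => hxA ?_⟩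
    by_cases hA3 : A.card = 3
    · rw [loweredWeight, if_pos hA3, ← h, sub_zero, max_eq_right (x.2.1 A)] at h0
      exact h0
    · rwa [loweredWeight, if_neg hA3] at h0
  · obtain ⟨T, hT, hlt⟩ := exists_threshold_lt h
    refine ⟨T, ?_⟩
    rw [loweredWeight, if_pos (mem_powersetCard.1 hT).2, max_eq_right (sub_pos.2 hlt).le]
    exact (sub_pos.2 hlt).ne'

theorem mem_of_singletonWeight_ne_zero {x : (concurrentComplex m).space} {A : Finset ℕ}
    (h : singletonWeight x A ≠ 0) : A ∈ powersetCard 1 (Icc 1 m) :=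
  by_contra fun hA => h (if_neg hA)

theorem exists_singletonWeight_ne_zero (x : (concurrentComplex m).space) :
    ∃ A, singletonWeight x A ≠ 0 := by
  obtain ⟨s, hs, hsx⟩ := AbsSC.exists_support x
  obtain ⟨i, hi, his⟩ := hs.2
  by_cases h : ∃ A ∈ s, A.card = 3
  · obtain ⟨T, hTs, hT3⟩ := h
    have hT : T ∈ powersetCard 3 (Icc 1 m) :=
      mem_powersetCard.2 ⟨(hs.1.2.1 T hTs).elim (·.1) (·.1), hT3⟩
    have hpos := threshold_pos hT ((hsx T).2 hTs)
    have hmiss : missingWeight x {i} = 0 := by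
      refine Finset.sum_eq_zero fun U hU => by_contra fun hxU => ?_
      obtain ⟨hU, hiU⟩ := mem_filter.1 hU
      exact hiU (singleton_subset_iff.2 (his U ((hsx U).1 hxU) (mem_powersetCard.1 hU).2))
    refine ⟨{i}, ?_⟩
    rw [singletonWeight, if_pos (mem_powersetCard.2 ⟨singleton_subset_iff.2 hi, card_singleton i⟩),
      hmiss, sub_zero, max_eq_right hpos.le]
    exact (add_pos_of_nonneg_of_pos (x.2.1 _) hpos).ne'
  · push Not at h
    obtain ⟨A, hA⟩ := hs.1.1
    have hA1 : A ∈ powersetCard 1 (Icc 1 m) :=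
      mem_powersetCard.2 ((hs.1.2.1 A hA).resolve_right fun h3 => h A hA h3.2)
    refine ⟨A, ?_⟩
    rw [singletonWeight, if_pos hA1]
    exact (add_pos_of_pos_of_nonneg ((x.2.1 A).lt_of_ne' ((hsx A).2 hA)) (le_max_left _ _)).ne'

/-- A singleton of positive weight is contained in every triple above the threshold. -/
theorem mem_of_singletonWeight_of_loweredWeight {x : (concurrentComplex m).space} {i : ℕ}
    {T : Finset ℕ} (hi : singletonWeight x {i} ≠ 0) (hT3 : T.card = 3)
    (hT : loweredWeight x T ≠ 0) : i ∈ T := by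
  obtain ⟨s, hs, hsx⟩ := AbsSC.exists_support x
  have hTs := (hsx T).1 (ne_zero_of_loweredWeight_ne_zero hT)
  by_cases hxi : x.1 {i} = 0
  · by_contra hiT
    refine hi ?_
    have hT' : T ∈ powersetCard 3 (Icc 1 m) :=
      mem_powersetCard.2 ⟨(hs.1.2.1 T hTs).elim (·.1) (·.1), hT3⟩
    have hle : x.1 T ≤ missingWeight x {i} := Finset.single_le_sum (f := x.1)
      (fun U _ => x.2.1 U) (mem_filter.2 ⟨hT', fun h => hiT (singleton_subset_iff.1 h)⟩)
    have hlt := threshold_lt_of_loweredWeight_ne_zero hT3 hT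
    rw [singletonWeight, hxi, max_eq_left (by linarith), add_zero, ite_self]
  · exact (card_symmDiff_singleton_le_iff hT3).1 (hs.1.2.2 _ ((hsx _).1 hxi) _ hTs)

theorem exists_face_loweredWeight_singletonWeight (x : (concurrentComplex m).space) :
    ∃ s ∈ (concurrentComplex m).faces,
      ∀ A, loweredWeight x A ≠ 0 ∨ singletonWeight x A ≠ 0 → A ∈ s := by
  classical
  obtain ⟨s, hs, hsx⟩ := AbsSC.exists_support x
  obtain ⟨B, hB⟩ := exists_singletonWeight_ne_zero x
  obtain ⟨hBm, hB1⟩ := mem_powersetCard.1 (mem_of_singletonWeight_ne_zero hB)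
  obtain ⟨i, rfl⟩ := card_eq_one.1 hB1
  let t := {A ∈ s | loweredWeight x A ≠ 0} ∪
    {A ∈ powersetCard 1 (Icc 1 m) | singletonWeight x A ≠ 0}
  have ht : ∀ {A}, A ∈ t → (A ∈ s ∧ loweredWeight x A ≠ 0) ∨
      (A ∈ powersetCard 1 (Icc 1 m) ∧ singletonWeight x A ≠ 0) := fun hA =>
    (mem_union.1 hA).imp mem_filter.1 mem_filter.1
  have hmixed : ∀ A C, A ∈ s → loweredWeight x A ≠ 0 → singletonWeight x C ≠ 0 →
      (symmDiff C A).card ≤ 2 := by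
    intro A C hA hlA hC
    obtain ⟨j, rfl⟩ := card_eq_one.1
      (mem_powersetCard.1 (mem_of_singletonWeight_ne_zero hC)).2
    rcases hs.1.2.1 A hA with hA1 | hA3
    · obtain ⟨k, rfl⟩ := card_eq_one.1 hA1.2
      exact card_symmDiff_singleton_singleton_le j k
    · exact (card_symmDiff_singleton_le_iff hA3.2).2
        (mem_of_singletonWeight_of_loweredWeight hC hA3.2 hlA)
  refine ⟨t, ⟨⟨⟨{i}, ?_⟩, fun A hA => ?_, fun A hA C hC => ?_⟩, i, singleton_subset_iff.1 hBm,
    fun A hA hA3 => ?_⟩, fun A hA => ?_⟩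
  · exact mem_union_right _ (mem_filter.2 ⟨mem_of_singletonWeight_ne_zero hB, hB⟩)
  · rcases ht hA with hA | hA
    · exact hs.1.2.1 A hA.1
    · exact Or.inl (mem_powersetCard.1 hA.1)
  · rcases ht hA with hA | hA <;> rcases ht hC with hC | hC
    · exact hs.1.2.2 A hA.1 C hC.1
    · rw [symmDiff_comm]
      exact hmixed A C hA.1 hA.2 hC.2
    · exact hmixed C A hC.1 hC.2 hA.2
    · obtain ⟨j, rfl⟩ := card_eq_one.1 (mem_powersetCard.1 hA.1).2
      obtain ⟨k, rfl⟩ := card_eq_one.1 (mem_powersetCard.1 hC.1).2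
      exact card_symmDiff_singleton_singleton_le j k
  · rcases ht hA with hA | hA
    · exact mem_of_singletonWeight_of_loweredWeight hB hA3 hA.2
    · have := (mem_powersetCard.1 hA.1).2
      omega
  · rcases hA with hA | hA
    · exact mem_union_left _
        (mem_filter.2 ⟨(hsx A).1 (ne_zero_of_loweredWeight_ne_zero hA), hA⟩)
    · exact mem_union_right _ (mem_filter.2 ⟨mem_of_singletonWeight_ne_zero hA, hA⟩)

/-- The complex of faces with concurrent triples is contractible: lower the weights of the triples,
move to the singletons contained in the remaining ones, and contract the simplex of singletons. -/
theorem contractibleSpace_concurrentComplex (hm : 1 ≤ m) :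
    ContractibleSpace (concurrentComplex m).space := by
  have hF : ∀ s ∈ (concurrentComplex m).faces,
      s ⊆ powersetCard 1 (Icc 1 m) ∪ powersetCard 3 (Icc 1 m) :=
    fun s hs => subset_of_mem_faces hs.1
  obtain ⟨f, -, hf⟩ := AbsSC.exists_normalize hF loweredWeight continuous_loweredWeight
    loweredWeight_nonneg (fun x => by
      obtain ⟨s, hs, h⟩ := exists_face_loweredWeight_singletonWeight x
      exact ⟨s, hs, fun A hA => h A (Or.inl hA)⟩) exists_loweredWeight_ne_zero
  obtain ⟨g, -, hg⟩ := AbsSC.exists_normalize hF singletonWeight continuous_singletonWeight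
    singletonWeight_nonneg (fun x => by
      obtain ⟨s, hs, h⟩ := exists_face_loweredWeight_singletonWeight x
      exact ⟨s, hs, fun A hA => h A (Or.inr hA)⟩) exists_singletonWeight_ne_zero
  have h1 : ({1} : Finset ℕ) ∈ powersetCard 1 (Icc 1 m) :=
    mem_powersetCard.2 ⟨singleton_subset_iff.2 (mem_Icc.2 ⟨le_rfl, hm⟩), card_singleton 1⟩
  have hy : ∀ A, (if A = {1} then 1 else 0 : ℝ) ≠ 0 → A ∈ powersetCard 1 (Icc 1 m) :=
    fun A hA => by
      rw [of_not_not fun h => hA (if_neg h)]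
      exact h1
  let y : (concurrentComplex m).space := ⟨fun A => if A = {1} then 1 else 0,
    fun A => by dsimp only; split_ifs <;> norm_num,
    powersetCard 1 (Icc 1 m), powersetCard_one_mem_faces hm, hy, by
      rw [Finset.sum_ite_eq', if_pos h1]⟩
  have H₁ := AbsSC.lineHomotopy (ContinuousMap.id _) f fun x => by
    obtain ⟨s, hs, hsx⟩ := AbsSC.exists_support x
    exact ⟨s, hs, fun A hA => (hsx A).1 (hA.elim id fun hA =>
      ne_zero_of_loweredWeight_ne_zero ((hf x A).1 hA))⟩
  have H₂ := AbsSC.lineHomotopy f g fun x => by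
    obtain ⟨s, hs, hsx⟩ := exists_face_loweredWeight_singletonWeight x
    exact ⟨s, hs, fun A hA => hsx A (hA.imp (hf x A).1 (hg x A).1)⟩
  have H₃ := AbsSC.lineHomotopy g (ContinuousMap.const _ y) fun x =>
    ⟨_, powersetCard_one_mem_faces hm, fun A hA => hA.elim
      (fun hA => mem_of_singletonWeight_ne_zero ((hg x A).1 hA)) (hy A)⟩
  exact (contractible_iff_id_nullhomotopic _).2 ⟨y, ⟨(H₁.trans H₂).trans H₃⟩⟩

end Contraction

end Rips

/-- For `m ≥ 5`, `VR(F_1^m ∪ F_3^m, 2)` is homotopy equivalent to a wedge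
of `C(m, 4)` copies of `S³`. -/
theorem stmt17 (m : ℕ) (hm : 5 ≤ m) :
    AbsSC.HEquivTop (VRc (Fnm m 1 ∪ Fnm m 3) 2) (WedgeSph 3 (m.choose 4)) := by
  have hm1 : 1 ≤ m := by omega
  obtain ⟨τ, hτ⟩ := exists_isCellAttachment hm1
  exact hτ.hEquivTop_wedgeSph (Nat.choose_pos (by omega)) (fun s hs => subset_of_mem_faces hs)
    (contractibleSpace_concurrentComplex hm1)
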